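/- arXiv:2312.14351 — 7 statements merged into one kernel-verified Lean document; each statement's English description precedes it below -/
import Mathlib

section
/- For every integer n ≥ 5, the number of permutations π in S_n such that π avoids the pattern 312 and π² avoids the pattern 213 is at least ⌊(10/7) · 2^{n−1}⌋, i.e., at least ⌊(10 · 2^{n−1})/7⌋. -/
/-- A permutation `π` of `Fin n` contains the pattern `τ` (a permutation of `Fin m`)
if there is a strictly increasing choice of `m` indices on which `π` is
order-isomorphic to `τ`. -/
def PermContains {n m : ℕ} (π : Equiv.Perm (Fin n)) (τ : Equiv.Perm (Fin m)) : Prop :=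
  ∃ f : Fin m → Fin n, StrictMono f ∧ ∀ i j : Fin m, τ i < τ j ↔ π (f i) < π (f j)

/-- `π` avoids the pattern `τ`. -/
def PermAvoids {n m : ℕ} (π : Equiv.Perm (Fin n)) (τ : Equiv.Perm (Fin m)) : Prop :=
  ¬ PermContains π τ

/-- The pattern 123 (one-line notation), as a permutation of `Fin 3`. -/
def p123 : Equiv.Perm (Fin 3) := ⟨![0,1,2], ![0,1,2], by decide, by decide⟩
/-- The pattern 132. -/
def p132 : Equiv.Perm (Fin 3) := ⟨![0,2,1], ![0,2,1], by decide, by decide⟩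
/-- The pattern 213. -/
def p213 : Equiv.Perm (Fin 3) := ⟨![1,0,2], ![1,0,2], by decide, by decide⟩
/-- The pattern 231. -/
def p231 : Equiv.Perm (Fin 3) := ⟨![1,2,0], ![2,0,1], by decide, by decide⟩
/-- The pattern 312. -/
def p312 : Equiv.Perm (Fin 3) := ⟨![2,0,1], ![1,2,0], by decide, by decide⟩
/-- The pattern 321. -/
def p321 : Equiv.Perm (Fin 3) := ⟨![2,1,0], ![2,1,0], by decide, by decide⟩

namespace PermChain

open Equiv

/-- `π` avoids 312 and `π ^ 2` avoids 213, spelled out by indices. -/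
def IsGood {n : ℕ} (π : Perm (Fin n)) : Prop :=
  (∀ i j k, i < j → j < k → π j < π k → ¬ π k < π i) ∧
  ∀ i j k, i < j → j < k → π (π j) < π (π i) → ¬ π (π i) < π (π k)

instance {n : ℕ} : DecidablePred (IsGood (n := n)) := fun π => by
  unfold IsGood; infer_instance

lemma IsGood.permAvoids {n : ℕ} {π : Perm (Fin n)} (h : IsGood π) :
    PermAvoids π p312 ∧ PermAvoids (π ^ 2) p213 := by
  constructor
  · rintro ⟨f, hf, hp⟩
    exact h.1 (f 0) (f 1) (f 2) (hf (by decide)) (hf (by decide))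
      ((hp 1 2).1 (by decide)) ((hp 2 0).1 (by decide))
  · rintro ⟨f, hf, hp⟩
    simp only [pow_two, Perm.mul_apply] at hp
    exact h.2 (f 0) (f 1) (f 2) (hf (by decide)) (hf (by decide))
      ((hp 1 0).1 (by decide)) ((hp 0 2).1 (by decide))

/-- `π` is the direct sum of a nonempty decreasing permutation and a nonempty permutation. -/
def StartsWithLayer {n : ℕ} (π : Perm (Fin (n + 1))) : Prop :=
  (π 0).val < n ∧ ∀ i, i ≤ π 0 → (π i).val + i.val = (π 0).val

instance {n : ℕ} : DecidablePred (StartsWithLayer (n := n)) := fun π => by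
  unfold StartsWithLayer; infer_instance

/-- Insert the value `p` in front of the one-line notation of `π`, shifting the values of `π`
that are at least `p`. -/
def insertHead {n : ℕ} (p : Fin (n + 1)) (π : Perm (Fin n)) : Perm (Fin (n + 1)) :=
  (finSuccEquiv' 0).trans ((optionCongr π).trans (finSuccEquiv' p).symm)

@[simp] lemma insertHead_zero {n : ℕ} (p : Fin (n + 1)) (π : Perm (Fin n)) :
    insertHead p π 0 = p := by
  simp [insertHead]

@[simp] lemma insertHead_succ {n : ℕ} (p : Fin (n + 1)) (π : Perm (Fin n)) (i : Fin n) :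
    insertHead p π i.succ = p.succAbove (π i) := by
  have h : finSuccEquiv' (0 : Fin (n + 1)) i.succ = some i :=
    finSuccEquiv'_succAbove (0 : Fin (n + 1)) i
  simp [insertHead, h]

lemma insertHead_inj {n : ℕ} {p q : Fin (n + 1)} {π σ : Perm (Fin n)}
    (h : insertHead p π = insertHead q σ) : π = σ := by
  have hpq : p = q := by simpa using congrArg (· 0) h
  subst hpq
  ext i : 1
  simpa using congrArg (· i.succ) h

/-- Prepending a fixed point preserves goodness. -/
lemma IsGood.insertHead_zero {n : ℕ} {π : Perm (Fin n)} (h : IsGood π) :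
    IsGood (insertHead 0 π) := by
  constructor
  · intro i j k hij hjk
    cases j using Fin.cases with
    | zero => simp at hij
    | succ j =>
      cases k using Fin.cases with
      | zero => simp at hjk
      | succ k =>
        cases i using Fin.cases with
        | zero => simp
        | succ i => simpa using h.1 i j k (by simpa using hij) (by simpa using hjk)
  · intro i j k hij hjk
    cases j using Fin.cases with
    | zero => simp at hij
    | succ j =>
      cases k using Fin.cases with
      | zero => simp at hjk
      | succ k =>
        cases i using Fin.cases with
        | zero => simp
        | succ i => simpa using h.2 i j k (by simpa using hij) (by simpa using hjk)

lemma startsWithLayer_insertHead_zero {n : ℕ} (π : Perm (Fin (n + 1))) :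
    StartsWithLayer (insertHead 0 π) := by
  refine ⟨by simp, fun i hi => ?_⟩
  obtain rfl : i = 0 := by simpa using hi
  simp

/-- Enlarge the first layer of `π` by one. -/
def growLayer {n : ℕ} (π : Perm (Fin (n + 1))) : Perm (Fin (n + 2)) :=
  insertHead (π 0).succ π

lemma growLayer_zero {n : ℕ} (π : Perm (Fin (n + 1))) : growLayer π 0 = (π 0).succ := by
  simp [growLayer]

lemma val_growLayer_succ {n : ℕ} (π : Perm (Fin (n + 1))) (i : Fin (n + 1)) :
    (growLayer π i.succ).val = if π i ≤ π 0 then (π i).val else (π i).val + 1 := by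
  rw [growLayer, insertHead_succ]
  split_ifs with h
  · rw [Fin.succAbove_of_castSucc_lt _ _ (by simpa [Fin.lt_def, Nat.lt_succ_iff] using h)]
    simp
  · rw [Fin.succAbove_of_lt_succ _ _ (by simpa using h)]
    simp

namespace StartsWithLayer

variable {n : ℕ} {π : Perm (Fin (n + 1))}

lemma le_iff (h : StartsWithLayer π) (i : Fin (n + 1)) : π i ≤ π 0 ↔ i ≤ π 0 := by
  constructor
  · intro hi
    have hlt : (π 0).val - (π i).val < n + 1 := by omega
    have hk := h.2 ⟨(π 0).val - (π i).val, hlt⟩ (Nat.sub_le _ _)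
    have : π ⟨(π 0).val - (π i).val, hlt⟩ = π i := by
      ext; simp only [Fin.le_def] at *; omega
    rw [← π.injective this]
    exact Nat.sub_le _ _
  · intro hi
    have := h.2 i hi
    simp only [Fin.le_def]; omega

lemma growLayer (h : StartsWithLayer π) : StartsWithLayer (growLayer π) := by
  have h0 := growLayer_zero π
  refine ⟨by rw [h0]; simpa using h.1, fun i hi => ?_⟩
  rw [h0] at hi ⊢
  cases i using Fin.cases with
  | zero => simp [h0]
  | succ i =>
    have hi' : i ≤ π 0 := by simpa using hi
    rw [val_growLayer_succ, if_pos ((h.le_iff i).2 hi')]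
    have := h.2 i hi'
    simp; omega

lemma sq_apply_of_le (h : StartsWithLayer π) {i : Fin (n + 1)} (hi : i ≤ π 0) :
    π (π i) = i := by
  have h1 := h.2 i hi
  have h2 := h.2 (π i) ((h.le_iff i).2 hi)
  ext; omega

lemma growLayer_succ (h : StartsWithLayer π) {i : Fin (n + 1)} (hi : ¬ i ≤ π 0) :
    PermChain.growLayer π i.succ = (π i).succ := by
  ext
  rw [val_growLayer_succ, if_neg (by rwa [h.le_iff])]
  simp

lemma isGood_growLayer (h : StartsWithLayer π) (hg : IsGood π) : IsGood (PermChain.growLayer π) := by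
  have h' := h.growLayer
  have h0 := growLayer_zero π
  constructor
  · intro i j k hij hjk hjk' hki
    cases j using Fin.cases with
    | zero => simp at hij
    | succ j =>
      cases k using Fin.cases with
      | zero => simp at hjk
      | succ k =>
        cases i using Fin.cases with
        | zero =>
          have hk := (h'.le_iff k.succ).1 hki.le
          have hj := (h'.le_iff j.succ).1 (hjk'.trans hki).le
          have := h'.2 _ hk
          have := h'.2 _ hj
          simp only [Fin.lt_def] at *; omega
        | succ i =>
          have hs {a b} := (Fin.strictMono_succAbove (π 0).succ).lt_iff_lt (a := a) (b := b)
          rw [PermChain.growLayer, insertHead_succ, insertHead_succ, hs] at hjk' hki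
          exact hg.1 i j k (by simpa using hij) (by simpa using hjk) hjk' hki
  · intro i j k hij hjk hji hik
    by_cases hi : i ≤ PermChain.growLayer π 0
    · rw [h'.sq_apply_of_le hi] at hji
      by_cases hj : j ≤ PermChain.growLayer π 0
      · rw [h'.sq_apply_of_le hj] at hji
        exact lt_asymm hij hji
      · exact hj ((h'.le_iff j).1 ((h'.le_iff _).1 (hji.le.trans hi)))
    · have key : ∀ l, ¬ l ≤ PermChain.growLayer π 0 → ∃ m : Fin (n + 1), l = m.succ ∧
          PermChain.growLayer π (PermChain.growLayer π l) = (π (π m)).succ := by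
        intro l hl
        cases l using Fin.cases with
        | zero => simp at hl
        | succ m =>
          have hm : ¬ m ≤ π 0 := by simpa [h0] using hl
          refine ⟨m, rfl, ?_⟩
          rw [h.growLayer_succ hm, h.growLayer_succ (by rwa [h.le_iff])]
      obtain ⟨a, rfl, ha⟩ := key i hi
      obtain ⟨b, rfl, hb⟩ := key j fun hj => hi (hij.le.trans hj)
      obtain ⟨c, rfl, hc⟩ := key k fun hk => hi ((hij.trans hjk).le.trans hk)
      rw [ha, hb] at hji
      rw [ha, hc] at hik
      exact hg.2 a b c (by simpa using hij) (by simpa using hjk) (by simpa using hji)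
        (by simpa using hik)

end StartsWithLayer

/-- The good permutations of `Fin (n + 1)`. -/
def goodPerms (n : ℕ) : Finset (Perm (Fin (n + 1))) := {π | IsGood π}

/-- The good permutations that start with a layer. -/
def layeredPerms (n : ℕ) : Finset (Perm (Fin (n + 1))) := {π | IsGood π ∧ StartsWithLayer π}

lemma card_layeredPerms_succ (n : ℕ) :
    (layeredPerms n).card + (goodPerms n).card ≤ (layeredPerms (n + 1)).card := by
  have hg : Set.InjOn growLayer (layeredPerms n : Set (Perm (Fin (n + 1)))) :=
    fun _ _ _ _ h => insertHead_inj h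
  have hi : Set.InjOn (insertHead 0) (goodPerms n : Set (Perm (Fin (n + 1)))) :=
    fun _ _ _ _ h => insertHead_inj h
  rw [← Finset.card_image_of_injOn hg, ← Finset.card_image_of_injOn hi,
    ← Finset.card_union_of_disjoint]
  · refine Finset.card_le_card (Finset.union_subset ?_ ?_)
    · intro σ hσ
      obtain ⟨π, hπ, rfl⟩ := Finset.mem_image.1 hσ
      simp only [layeredPerms, Finset.mem_filter_univ] at hπ ⊢
      exact ⟨hπ.2.isGood_growLayer hπ.1, hπ.2.growLayer⟩
    · intro σ hσ
      obtain ⟨π, hπ, rfl⟩ := Finset.mem_image.1 hσ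
      simp only [layeredPerms, goodPerms, Finset.mem_filter_univ] at hπ ⊢
      exact ⟨hπ.insertHead_zero, startsWithLayer_insertHead_zero π⟩
  · rw [Finset.disjoint_left]
    intro σ hσ hσ'
    obtain ⟨π, -, rfl⟩ := Finset.mem_image.1 hσ
    obtain ⟨τ, -, h⟩ := Finset.mem_image.1 hσ'
    have := congrArg (· 0) h
    rw [growLayer_zero, PermChain.insertHead_zero] at this
    exact Fin.succ_ne_zero _ this.symm

lemma layeredPerms_subset (n : ℕ) : layeredPerms n ⊆ goodPerms n :=
  Finset.monotone_filter_right _ fun _ _ h => h.1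

lemma card_layeredPerms_add_le {n : ℕ} (s : Finset (Perm (Fin (n + 1))))
    (hs : ∀ π ∈ s, IsGood π ∧ ¬ StartsWithLayer π) :
    (layeredPerms n).card + s.card ≤ (goodPerms n).card := by
  rw [← Finset.card_union_of_disjoint]
  · refine Finset.card_le_card (Finset.union_subset (layeredPerms_subset n) fun π hπ => ?_)
    simpa [goodPerms] using (hs π hπ).1
  · rw [Finset.disjoint_left]
    intro π hπ hπ'
    simp only [layeredPerms, Finset.mem_filter_univ] at hπ
    exact (hs π hπ').2 hπ.2

/-- The permutation with one-line notation `f` and inverse `g`. -/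
abbrev ofVec {n : ℕ} (f g : Fin n → Fin n) (h : ∀ i, g (f i) = i ∧ f (g i) = i) : Perm (Fin n) :=
  ⟨f, g, fun i => (h i).1, fun i => (h i).2⟩

lemma card_goodPerms_two : (layeredPerms 2).card + 2 ≤ (goodPerms 2).card :=
  card_layeredPerms_add_le {Fin.revPerm, finRotate 3} (by decide)

lemma card_goodPerms_three : (layeredPerms 3).card + 3 ≤ (goodPerms 3).card :=
  card_layeredPerms_add_le
    {Fin.revPerm, finRotate 4, ofVec ![1, 3, 2, 0] ![3, 0, 2, 1] (by decide)} (by decide)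

set_option maxRecDepth 4000 in
lemma card_goodPerms_four : (layeredPerms 4).card + 4 ≤ (goodPerms 4).card :=
  card_layeredPerms_add_le
    {Fin.revPerm, finRotate 5,
      ofVec ![1, 3, 2, 4, 0] ![4, 0, 2, 1, 3] (by decide),
      ofVec ![1, 4, 3, 2, 0] ![4, 0, 3, 2, 1] (by decide)} (by decide)

set_option maxRecDepth 4000 in
lemma card_goodPerms_five : (layeredPerms 5).card + 7 ≤ (goodPerms 5).card :=
  card_layeredPerms_add_le
    {Fin.revPerm, finRotate 6,
      ofVec ![1, 2, 4, 3, 5, 0] ![5, 0, 1, 3, 2, 4] (by decide),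
      ofVec ![1, 4, 3, 2, 5, 0] ![5, 0, 3, 2, 1, 4] (by decide),
      ofVec ![1, 5, 4, 3, 2, 0] ![5, 0, 4, 3, 2, 1] (by decide),
      ofVec ![2, 3, 5, 4, 1, 0] ![5, 4, 0, 1, 3, 2] (by decide),
      ofVec ![3, 2, 5, 4, 1, 0] ![5, 4, 1, 0, 3, 2] (by decide)} (by decide)

lemma card_goodPerms_of_revPerm (n : ℕ) : (layeredPerms n).card + 1 ≤ (goodPerms n).card := by
  refine card_layeredPerms_add_le {Fin.revPerm} ?_
  simp only [Finset.mem_singleton, forall_eq, IsGood, StartsWithLayer, Fin.revPerm_apply,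
    Fin.rev_rev, Fin.rev_lt_rev]
  refine ⟨⟨fun i j k _ hjk hkj => (lt_asymm hjk hkj).elim,
    fun i j k hij _ hji => (lt_asymm hij hji).elim⟩, fun h => ?_⟩
  simp at h

lemma card_layeredPerms_ge (n : ℕ) : 183 * 2 ^ n ≤ (layeredPerms (n + 7)).card := by
  induction n with
  | zero =>
    have h0 := card_goodPerms_of_revPerm 0
    have h1 := card_goodPerms_of_revPerm 1
    have h6 := card_goodPerms_of_revPerm 6
    linarith [card_layeredPerms_succ 0, card_layeredPerms_succ 1, card_layeredPerms_succ 2,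
      card_layeredPerms_succ 3, card_layeredPerms_succ 4, card_layeredPerms_succ 5,
      card_layeredPerms_succ 6, card_goodPerms_two, card_goodPerms_three, card_goodPerms_four,
      card_goodPerms_five]
  | succ n ih =>
    have := card_layeredPerms_succ (n + 7)
    have := card_goodPerms_of_revPerm (n + 7)
    rw [show n + 1 + 7 = n + 7 + 1 by ring, pow_succ]
    omega

lemma card_goodPerms_ge (n : ℕ) (hn : 4 ≤ n) : 10 * 2 ^ n / 7 ≤ (goodPerms n).card := by
  by_cases h : 7 ≤ n
  · obtain ⟨m, rfl⟩ := Nat.exists_eq_add_of_le' h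
    have h1 := card_layeredPerms_ge m
    have h2 := Finset.card_le_card (layeredPerms_subset (m + 7))
    rw [pow_add]
    omega
  · have h0 := card_goodPerms_of_revPerm 0
    have h1 := card_goodPerms_of_revPerm 1
    have h2 := card_goodPerms_two
    have h3 := card_goodPerms_three
    have h4 := card_goodPerms_four
    have h5 := card_goodPerms_five
    have h6 := card_goodPerms_of_revPerm 6
    have s0 := card_layeredPerms_succ 0
    have s1 := card_layeredPerms_succ 1
    have s2 := card_layeredPerms_succ 2
    have s3 := card_layeredPerms_succ 3
    have s4 := card_layeredPerms_succ 4
    have s5 := card_layeredPerms_succ 5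
    simp only [Nat.reduceAdd] at s0 s1 s2 s3 s4 s5
    interval_cases n <;> omega

end PermChain

theorem stmt9 (n : ℕ) (hn : 5 ≤ n) :
    10 * 2 ^ (n - 1) / 7 ≤ Nat.card {π : Equiv.Perm (Fin n) //
      PermAvoids π p312 ∧ PermAvoids (π ^ 2) p213} := by
  obtain ⟨m, rfl⟩ : ∃ m, n = m + 1 := ⟨n - 1, by omega⟩
  refine (PermChain.card_goodPerms_ge m (by omega)).trans ?_
  rw [← Nat.card_eq_finsetCard]
  refine Nat.card_le_card_of_injective
    (fun π => ⟨π.1, ((Finset.mem_filter_univ _).1 π.2).permAvoids⟩) fun π σ h => ?_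
  exact Subtype.ext (Subtype.mk.inj h)
end

section
/- For every integer n ≥ 3, let c_j denote the number of permutations π ∈ S_j such that π avoids 312 and π² avoids 231 (with c_0 = 1), and for i ≥ 1 let a_i denote the number of permutations π ∈ S_i such that π avoids 312, π² avoids 231, and π_i = 1 (π ends in 1). Then c_n = Σ_{i=1}^{n} a_i · c_{n−i}. -/
namespace PermPattern

theorem contains_p312_iff {n : ℕ} (π : Equiv.Perm (Fin n)) :
    PermContains π p312 ↔ ∃ i j k : Fin n, i < j ∧ j < k ∧ π j < π k ∧ π k < π i := by
  constructor
  · rintro ⟨f, hf, h⟩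
    exact ⟨f 0, f 1, f 2, hf (by decide), hf (by decide), (h 1 2).1 (by decide),
      (h 2 0).1 (by decide)⟩
  · rintro ⟨i, j, k, hij, hjk, h₁, h₂⟩
    refine ⟨![i, j, k], ?_, ?_⟩
    · intro x y hxy
      fin_cases x <;> fin_cases y <;> simp_all [hij.trans hjk]
    · intro x y
      fin_cases x <;> fin_cases y <;> simp [p312] <;> omega

theorem contains_p231_iff {n : ℕ} (π : Equiv.Perm (Fin n)) :
    PermContains π p231 ↔ ∃ i j k : Fin n, i < j ∧ j < k ∧ π k < π i ∧ π i < π j := by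
  constructor
  · rintro ⟨f, hf, h⟩
    exact ⟨f 0, f 1, f 2, hf (by decide), hf (by decide), (h 2 0).1 (by decide),
      (h 0 1).1 (by decide)⟩
  · rintro ⟨i, j, k, hij, hjk, h₁, h₂⟩
    refine ⟨![i, j, k], ?_, ?_⟩
    · intro x y hxy
      fin_cases x <;> fin_cases y <;> simp_all [hij.trans hjk]
    · intro x y
      fin_cases x <;> fin_cases y <;> simp [p231] <;> omega

/-- The direct sum `α ⊕ τ` of two permutations in one-line notation. -/
def directSum {a b : ℕ} (α : Equiv.Perm (Fin a)) (τ : Equiv.Perm (Fin b)) :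
    Equiv.Perm (Fin (a + b)) :=
  finSumFinEquiv.permCongr (Equiv.sumCongr α τ)

variable {a b : ℕ}

@[simp]
theorem directSum_castAdd (α : Equiv.Perm (Fin a)) (τ : Equiv.Perm (Fin b)) (i : Fin a) :
    directSum α τ (Fin.castAdd b i) = Fin.castAdd b (α i) := by
  simp [directSum, Equiv.permCongr_apply]

@[simp]
theorem directSum_natAdd (α : Equiv.Perm (Fin a)) (τ : Equiv.Perm (Fin b)) (i : Fin b) :
    directSum α τ (Fin.natAdd a i) = Fin.natAdd a (τ i) := by
  simp [directSum, Equiv.permCongr_apply]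

theorem directSum_sq (α : Equiv.Perm (Fin a)) (τ : Equiv.Perm (Fin b)) :
    directSum α τ ^ 2 = directSum (α ^ 2) (τ ^ 2) := by
  refine Equiv.ext fun i => ?_
  refine Fin.addCases (fun i => ?_) (fun i => ?_) i <;> simp [sq]

theorem directSum_injective :
    Function.Injective fun p : Equiv.Perm (Fin a) × Equiv.Perm (Fin b) =>
      directSum p.1 p.2 := by
  intro p q h
  exact Equiv.Perm.sumCongrHom_injective (finSumFinEquiv.permCongr.injective h)

theorem exists_directSum (π : Equiv.Perm (Fin (a + b)))
    (h : ∀ i : Fin (a + b), (i : ℕ) < a → (π i : ℕ) < a) :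
    ∃ α τ, directSum α τ = π := by
  have hmem : finSumFinEquiv.symm.permCongr π ∈
      (Equiv.Perm.sumCongrHom (Fin a) (Fin b)).range := by
    apply Equiv.Perm.mem_sumCongrHom_range_of_perm_mapsTo_inl
    rintro _ ⟨i, rfl⟩
    refine ⟨⟨π (Fin.castAdd b i), h _ i.isLt⟩, ?_⟩
    apply finSumFinEquiv.injective
    ext
    simp [Equiv.permCongr_apply]
  obtain ⟨p, hp⟩ := hmem
  refine ⟨p.1, p.2, ?_⟩
  change finSumFinEquiv.permCongr (Equiv.Perm.sumCongrHom _ _ p) = π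
  rw [hp]
  ext
  simp [Equiv.permCongr_apply]

theorem avoids_p312_directSum (α : Equiv.Perm (Fin a)) (τ : Equiv.Perm (Fin b)) :
    PermAvoids (directSum α τ) p312 ↔ PermAvoids α p312 ∧ PermAvoids τ p312 := by
  simp only [PermAvoids, contains_p312_iff, ← not_or]
  refine not_congr ⟨?_, ?_⟩
  · rintro ⟨i, j, k, h⟩
    revert h
    refine Fin.addCases (fun i => ?_) (fun i => ?_) i <;>
    refine Fin.addCases (fun j => ?_) (fun j => ?_) j <;>
    refine Fin.addCases (fun k => ?_) (fun k => ?_) k <;>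
    simp only [directSum_castAdd, directSum_natAdd, Fin.lt_def, Fin.val_castAdd,
      Fin.val_natAdd] <;> intro h
    · exact .inl ⟨i, j, k, h⟩
    all_goals first | omega | exact .inr ⟨i, j, k, by omega⟩
  · rintro (⟨i, j, k, h⟩ | ⟨i, j, k, h⟩)
    · exact ⟨Fin.castAdd b i, Fin.castAdd b j, Fin.castAdd b k, by
        simp only [directSum_castAdd]; exact h⟩
    · exact ⟨Fin.natAdd a i, Fin.natAdd a j, Fin.natAdd a k, by simpa using h⟩

theorem avoids_p231_directSum (α : Equiv.Perm (Fin a)) (τ : Equiv.Perm (Fin b)) :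
    PermAvoids (directSum α τ) p231 ↔ PermAvoids α p231 ∧ PermAvoids τ p231 := by
  simp only [PermAvoids, contains_p231_iff, ← not_or]
  refine not_congr ⟨?_, ?_⟩
  · rintro ⟨i, j, k, h⟩
    revert h
    refine Fin.addCases (fun i => ?_) (fun i => ?_) i <;>
    refine Fin.addCases (fun j => ?_) (fun j => ?_) j <;>
    refine Fin.addCases (fun k => ?_) (fun k => ?_) k <;>
    simp only [directSum_castAdd, directSum_natAdd, Fin.lt_def, Fin.val_castAdd,
      Fin.val_natAdd] <;> intro h
    · exact .inl ⟨i, j, k, h⟩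
    all_goals first | omega | exact .inr ⟨i, j, k, by omega⟩
  · rintro (⟨i, j, k, h⟩ | ⟨i, j, k, h⟩)
    · exact ⟨Fin.castAdd b i, Fin.castAdd b j, Fin.castAdd b k, by
        simp only [directSum_castAdd]; exact h⟩
    · exact ⟨Fin.natAdd a i, Fin.natAdd a j, Fin.natAdd a k, by simpa using h⟩

/-- `π` avoids 312 and `π ^ 2` avoids 231. -/
abbrev Good {n : ℕ} (π : Equiv.Perm (Fin n)) : Prop :=
  PermAvoids π p312 ∧ PermAvoids (π ^ 2) p231

theorem good_directSum (α : Equiv.Perm (Fin a)) (τ : Equiv.Perm (Fin b)) :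
    Good (directSum α τ) ↔ Good α ∧ Good τ := by
  rw [Good, directSum_sq, avoids_p312_directSum, avoids_p231_directSum]
  tauto

/-- In a 312-avoiding permutation, the positions up to that of the minimum are mapped to
themselves. -/
theorem apply_le_of_avoids_p312 {n : ℕ} {π : Equiv.Perm (Fin n)} (hπ : PermAvoids π p312)
    {m : Fin n} (hm : (π m : ℕ) = 0) {i : Fin n} (hi : i ≤ m) : π i ≤ m := by
  rcases hi.eq_or_lt with rfl | hi
  · rw [Fin.le_def, hm]
    exact Nat.zero_le _
  have hsub : (Finset.Ioi m).map π.toEmbedding ⊆ Finset.Ioi (π i) := by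
    intro y hy
    obtain ⟨j, hj, rfl⟩ := Finset.mem_map.1 hy
    rw [Finset.mem_Ioi] at hj ⊢
    by_contra hlt
    have hne : π j ≠ π i := fun h => (hi.trans hj).ne' (π.injective h)
    have hne' : π j ≠ π m := fun h => hj.ne' (π.injective h)
    refine hπ ((contains_p312_iff π).2 ⟨i, m, j, hi, hj, ?_, ?_⟩)
    · rw [Fin.lt_def]
      have := Fin.val_ne_of_ne hne'
      omega
    · exact lt_of_le_of_ne (not_lt.1 hlt) hne
  have hcard := Finset.card_le_card hsub
  rw [Finset.card_map, Fin.card_Ioi, Fin.card_Ioi] at hcard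
  rw [Fin.le_def]
  omega

theorem card_good_apply_eq_zero (m k : ℕ) :
    Nat.card {π : Equiv.Perm (Fin (m + 1 + k)) //
        Good π ∧ (π (Fin.castAdd k (Fin.last m)) : ℕ) = 0} =
      Nat.card {π : Equiv.Perm (Fin (m + 1)) // Good π ∧ π (Fin.last m) = 0} *
        Nat.card {π : Equiv.Perm (Fin k) // Good π} := by
  rw [← Nat.card_prod]
  symm
  refine Nat.card_congr (Equiv.ofBijective
    (fun p => ⟨directSum p.1.1 p.2.1, (good_directSum _ _).2 ⟨p.1.2.1, p.2.2⟩, by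
      simp [p.1.2.2]⟩) ⟨?_, ?_⟩)
  · rintro ⟨p, q⟩ ⟨p', q'⟩ h
    have h' := directSum_injective (a₁ := (p.1, q.1)) (a₂ := (p'.1, q'.1))
      (congrArg Subtype.val h)
    simp only [Prod.mk.injEq] at h'
    exact Prod.ext (Subtype.ext h'.1) (Subtype.ext h'.2)
  · rintro ⟨π, hπ, h0⟩
    obtain ⟨α, τ, rfl⟩ := exists_directSum π (fun i hi => by
      have := apply_le_of_avoids_p312 hπ.1 h0 (i := i) (by
        simp only [Fin.le_def, Fin.val_castAdd, Fin.val_last]; omega)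
      simp only [Fin.le_def, Fin.val_castAdd, Fin.val_last] at this
      omega)
    have hg := (good_directSum α τ).1 hπ
    exact ⟨(⟨α, hg.1, Fin.ext (by simpa using h0)⟩, ⟨τ, hg.2⟩), rfl⟩

theorem card_good_eq_sum (n : ℕ) (hn : 0 < n) :
    Nat.card {π : Equiv.Perm (Fin n) // Good π} =
      ∑ m : Fin n, Nat.card {π : Equiv.Perm (Fin n) // Good π ∧ (π m : ℕ) = 0} := by
  rw [← Nat.card_sigma]
  refine Nat.card_congr (Equiv.ofBijective
    (fun π => ⟨π.1.symm ⟨0, hn⟩, π.1, π.2, by simp⟩) ⟨?_, ?_⟩)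
  · intro π π' h
    exact Subtype.ext (congrArg (fun s => s.2.1) h)
  · rintro ⟨m, π, hπ, h0⟩
    obtain rfl : m = π.symm ⟨0, hn⟩ := by
      rw [Equiv.eq_symm_apply]
      exact Fin.ext h0
    exact ⟨⟨π, hπ⟩, rfl⟩

end PermPattern

theorem stmt10 (n : ℕ) (hn : 3 ≤ n) (c a : ℕ → ℕ)
    (hc : ∀ m : ℕ, c m = Nat.card {π : Equiv.Perm (Fin m) //
      PermAvoids π p312 ∧ PermAvoids (π ^ 2) p231})
    (ha : ∀ m : ℕ, a (m + 1) = Nat.card {π : Equiv.Perm (Fin (m + 1)) //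
      (PermAvoids π p312 ∧ PermAvoids (π ^ 2) p231) ∧ π (Fin.last m) = 0}) :
    c n = ∑ i ∈ Finset.Icc 1 n, a i * c (n - i) := by
  rw [hc n, PermPattern.card_good_eq_sum n (by omega), ← Finset.Ico_add_one_right_eq_Icc,
    Finset.sum_Ico_eq_sum_range, Finset.sum_range]
  refine Finset.sum_congr rfl fun m _ => ?_
  obtain ⟨m, hm⟩ := m
  obtain ⟨k, rfl⟩ := Nat.exists_eq_add_of_le (Nat.succ_le_of_lt hm)
  have hk : m + 1 + k - (1 + m) = k := by omega
  rw [hk, Nat.add_comm 1 m, ha, hc]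
  exact PermPattern.card_good_apply_eq_zero m k
end

section
/- Let (b_n) be the sequence defined by b_0 = b_1 = 1 and, for n ≥ 2, b_n = b_{n−1} + Σ_{i=2}^{n} ⌊i/2⌋ · b_{n−i}. Then for every integer n ≥ 1, the number of permutations π in S_n such that π avoids the pattern 312 and π² avoids the pattern 231 is at least b_n. -/
/-- Functions `ℕ → ℕ` which restrict to a permutation of `{0, …, n - 1}` avoiding 312 and with
square avoiding 231, and which fix all `x ≥ n`. -/
structure IsGoodPerm (n : ℕ) (f : ℕ → ℕ) : Prop where
  injective : ∀ x y, f x = f y → x = y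
  lt : ∀ x, x < n → f x < n
  fixed : ∀ x, n ≤ x → f x = x
  avoids : ∀ x y z, x < y → y < z → f y < f z → ¬ f z < f x
  sq_avoids : ∀ x y z, x < y → y < z → f (f z) < f (f x) → ¬ f (f x) < f (f y)

/-- The direct sum of the permutation `(i-j+1) ⋯ i (i-j) ⋯ 1` of size `i` with `f`. -/
def blockSum (i j : ℕ) (f : ℕ → ℕ) (x : ℕ) : ℕ :=
  if x < i then (if x < j then i - j + x else i - 1 - x) else i + f (x - i)

lemma blockSum_blockSum {i j : ℕ} (f : ℕ → ℕ) (hij : i = 1 ∧ j = 1 ∨ 1 ≤ j ∧ 2 * j ≤ i) (x : ℕ) :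
    blockSum i j f (blockSum i j f x) =
      if x < i then (if x < j then j - 1 - x else if x < i - j then x else 2 * i - j - 1 - x)
      else i + f (f (x - i)) := by
  by_cases h : x < i
  · simp only [blockSum, h, if_true]
    split_ifs <;> omega
  · have : blockSum i j f x = i + f (x - i) := by simp [blockSum, h]
    rw [this]
    simp [blockSum, h]

lemma IsGoodPerm.blockSum {i j m : ℕ} {f : ℕ → ℕ} (hf : IsGoodPerm m f)
    (hij : i = 1 ∧ j = 1 ∨ 1 ≤ j ∧ 2 * j ≤ i) : IsGoodPerm (i + m) (blockSum i j f) where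
  injective x y h := by
    have := hf.injective (x - i) (y - i)
    simp only [_root_.blockSum] at h
    split_ifs at h <;> omega
  lt x hx := by
    have := hf.lt (x - i)
    simp only [_root_.blockSum]
    split_ifs <;> omega
  fixed x hx := by
    have := hf.fixed (x - i)
    simp only [_root_.blockSum]
    split_ifs <;> omega
  avoids x y z hxy hyz := by
    have := hf.avoids (x - i) (y - i) (z - i)
    simp only [_root_.blockSum]
    split_ifs <;> omega
  sq_avoids x y z hxy hyz := by
    have := hf.sq_avoids (x - i) (y - i) (z - i)
    simp only [blockSum_blockSum f hij]
    split_ifs <;> omega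

lemma blockSum_injective {i j i' j' : ℕ} {f f' : ℕ → ℕ}
    (hij : i = 1 ∧ j = 1 ∨ 1 ≤ j ∧ 2 * j ≤ i) (hij' : i' = 1 ∧ j' = 1 ∨ 1 ≤ j' ∧ 2 * j' ≤ i')
    (h : blockSum i j f = blockSum i' j' f') : i = i' ∧ j = j' ∧ f = f' := by
  have hi : i = i' := by
    have h1 := congrFun h (i - 1)
    have h2 := congrFun h (i' - 1)
    simp only [blockSum] at h1 h2
    split_ifs at h1 h2 <;> omega
  subst hi
  refine ⟨rfl, ?_, ?_⟩
  · have h0 := congrFun h 0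
    simp only [blockSum] at h0
    split_ifs at h0 <;> omega
  · funext x
    simpa [blockSum] using congrFun h (i + x)

lemma exists_finset_isGoodPerm (b : ℕ → ℕ) (hb0 : b 0 = 1) (hb1 : b 1 = 1)
    (hb : ∀ n : ℕ, 2 ≤ n → b n = b (n - 1) + ∑ i ∈ Finset.Icc 2 n, (i / 2) * b (n - i)) (n : ℕ) :
    ∃ S : Finset (ℕ → ℕ), S.card = b n ∧ ∀ f ∈ S, IsGoodPerm n f := by
  classical
  induction n using Nat.strong_induction_on with
  | _ n ih =>
  rcases Nat.eq_zero_or_pos n with rfl | hn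
  · refine ⟨{id}, by simp [hb0], ?_⟩
    simp only [Finset.mem_singleton, forall_eq]
    constructor <;> intros <;> simp_all <;> omega
  have hsum : b n = ∑ i ∈ Finset.Icc 1 n, max 1 (i / 2) * b (n - i) := by
    rw [← Finset.add_sum_Ioc_eq_sum_Icc hn]
    have hIoc : Finset.Ioc 1 n = Finset.Icc 2 n := by ext; simp; omega
    rw [hIoc]
    rcases Nat.lt_or_ge n 2 with h | h
    · obtain rfl : n = 1 := by omega
      simp [hb0, hb1]
    · rw [hb n h]
      congr 1
      · simp
      · refine Finset.sum_congr rfl fun i hi => ?_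
        have := Finset.mem_Icc.1 hi
        rw [max_eq_right (by omega)]
  choose! S hcard hgood using ih
  have hIcc : ∀ {i j : ℕ}, 1 ≤ i → j ∈ Finset.Icc 1 (max 1 (i / 2)) →
      i = 1 ∧ j = 1 ∨ 1 ≤ j ∧ 2 * j ≤ i := fun hi hj => by
    rw [Finset.mem_Icc] at hj
    omega
  let T : Finset (Σ _ : ℕ, ℕ × (ℕ → ℕ)) :=
    (Finset.Icc 1 n).sigma fun i => Finset.Icc 1 (max 1 (i / 2)) ×ˢ S (n - i)
  refine ⟨T.image fun p => blockSum p.1 p.2.1 p.2.2, ?_, ?_⟩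
  · rw [Finset.card_image_of_injOn, Finset.card_sigma, hsum]
    · refine Finset.sum_congr rfl fun i hi => ?_
      have := Finset.mem_Icc.1 hi
      rw [Finset.card_product, hcard _ (by omega)]
      simp
    · rintro ⟨i, j, f⟩ hp ⟨i', j', f'⟩ hp' h
      simp only [T, Finset.mem_coe, Finset.mem_sigma, Finset.mem_product] at hp hp'
      obtain ⟨rfl, rfl, rfl⟩ := blockSum_injective
        (hIcc (Finset.mem_Icc.1 hp.1).1 hp.2.1) (hIcc (Finset.mem_Icc.1 hp'.1).1 hp'.2.1) h
      rfl
  · intro g hg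
    obtain ⟨⟨i, j, f⟩, hp, rfl⟩ := Finset.mem_image.1 hg
    simp only [T, Finset.mem_sigma, Finset.mem_product] at hp
    have hi := Finset.mem_Icc.1 hp.1
    have := (hgood (n - i) (by omega) f hp.2.2).blockSum (hIcc hi.1 hp.2.1)
    rwa [Nat.add_sub_cancel' hi.2] at this

/-- The permutation of `Fin n` obtained by restricting `f`. -/
noncomputable def IsGoodPerm.toPerm {n : ℕ} {f : ℕ → ℕ} (hf : IsGoodPerm n f) :
    Equiv.Perm (Fin n) :=
  Equiv.ofBijective (fun x => ⟨f x, hf.lt x x.2⟩) <| Finite.injective_iff_bijective.1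
    fun x y h => Fin.ext (hf.injective x y (congrArg Fin.val h))

lemma IsGoodPerm.toPerm_val {n : ℕ} {f : ℕ → ℕ} (hf : IsGoodPerm n f) (x : Fin n) :
    (hf.toPerm x : ℕ) = f x := rfl

lemma IsGoodPerm.permAvoids_toPerm {n : ℕ} {f : ℕ → ℕ} (hf : IsGoodPerm n f) :
    PermAvoids hf.toPerm p312 := by
  rintro ⟨g, hg, h⟩
  have h1 := (h 1 2).1 (by decide)
  have h2 := (h 2 0).1 (by decide)
  exact hf.avoids (g 0) (g 1) (g 2) (hg (by decide)) (hg (by decide)) h1 h2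

lemma IsGoodPerm.permAvoids_toPerm_sq {n : ℕ} {f : ℕ → ℕ} (hf : IsGoodPerm n f) :
    PermAvoids (hf.toPerm ^ 2) p231 := by
  rintro ⟨g, hg, h⟩
  have h1 := (h 2 0).1 (by decide)
  have h2 := (h 0 1).1 (by decide)
  rw [pow_two] at h1 h2
  exact hf.sq_avoids (g 0) (g 1) (g 2) (hg (by decide)) (hg (by decide)) h1 h2

theorem stmt11 (b : ℕ → ℕ) (hb0 : b 0 = 1) (hb1 : b 1 = 1)
    (hb : ∀ n : ℕ, 2 ≤ n → b n = b (n - 1) + ∑ i ∈ Finset.Icc 2 n, (i / 2) * b (n - i))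
    (n : ℕ) (hn : 1 ≤ n) :
    b n ≤ Nat.card {π : Equiv.Perm (Fin n) //
      PermAvoids π p312 ∧ PermAvoids (π ^ 2) p231} := by
  obtain ⟨S, hcard, hS⟩ := exists_finset_isGoodPerm b hb0 hb1 hb n
  rw [← hcard, ← Nat.card_eq_finsetCard S]
  refine Nat.card_le_card_of_injective (fun f : S => ⟨(hS f f.2).toPerm,
    (hS f f.2).permAvoids_toPerm, (hS f f.2).permAvoids_toPerm_sq⟩) fun f f' h => ?_
  have h' := congrArg Subtype.val h
  refine Subtype.ext (funext fun x => ?_)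
  rcases Nat.lt_or_ge x n with hx | hx
  · exact congrArg Fin.val (Equiv.congr_fun h' ⟨x, hx⟩)
  · rw [(hS f f.2).fixed x hx, (hS f' f'.2).fixed x hx]
end

section
/- For every integer n ≥ 3, let c_j denote the number of permutations π ∈ S_j such that π avoids 312 and π² avoids 321 (with c_0 = 1), and for i ≥ 1 let a_i denote the number of permutations π ∈ S_i such that π avoids 312, π² avoids 321, and π_i = 1 (π ends in 1). Then c_n = Σ_{i=1}^{n} a_i · c_{n−i}. -/
theorem permAvoids_p312_iff {n : ℕ} (π : Equiv.Perm (Fin n)) :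
    PermAvoids π p312 ↔ ∀ i j k : Fin n, i < j → j < k → π j < π k → ¬ π k < π i := by
  constructor
  · intro h i j k hij hjk h1 h2
    refine h ⟨![i, j, k], ?_, ?_⟩
    · intro a b hab
      fin_cases a <;> fin_cases b <;> simp_all [hij.trans hjk]
    · intro a b
      fin_cases a <;> fin_cases b <;> simp [p312, h1, h2, h1.le, h2.le, h1.trans h2, (h1.trans h2).le]
  · rintro h ⟨f, hf, h'⟩
    exact h (f 0) (f 1) (f 2) (hf (by decide)) (hf (by decide))
      ((h' 1 2).1 (by decide)) ((h' 2 0).1 (by decide))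

theorem permAvoids_p321_iff {n : ℕ} (π : Equiv.Perm (Fin n)) :
    PermAvoids π p321 ↔ ∀ i j k : Fin n, i < j → j < k → π k < π j → ¬ π j < π i := by
  constructor
  · intro h i j k hij hjk h1 h2
    refine h ⟨![i, j, k], ?_, ?_⟩
    · intro a b hab
      fin_cases a <;> fin_cases b <;> simp_all [hij.trans hjk]
    · intro a b
      fin_cases a <;> fin_cases b <;> simp [p321, h1, h2, h1.le, h2.le, h1.trans h2, (h1.trans h2).le]
  · rintro h ⟨f, hf, h'⟩
    exact h (f 0) (f 1) (f 2) (hf (by decide)) (hf (by decide))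
      ((h' 2 1).1 (by decide)) ((h' 1 0).1 (by decide))

/-- The direct sum of two permutations: `σ` on the first `m` points, `τ` on the last `l`. -/
def permDirectSum {m l : ℕ} (σ : Equiv.Perm (Fin m)) (τ : Equiv.Perm (Fin l)) :
    Equiv.Perm (Fin (m + l)) :=
  finSumFinEquiv.permCongr (Equiv.Perm.sumCongr σ τ)

section permDirectSum

variable {m l : ℕ} (σ : Equiv.Perm (Fin m)) (τ : Equiv.Perm (Fin l))

@[simp]
theorem permDirectSum_castAdd (i : Fin m) :
    permDirectSum σ τ (Fin.castAdd l i) = Fin.castAdd l (σ i) := by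
  simp [permDirectSum, Equiv.permCongr_apply]

@[simp]
theorem permDirectSum_natAdd (i : Fin l) :
    permDirectSum σ τ (Fin.natAdd m i) = Fin.natAdd m (τ i) := by
  simp [permDirectSum, Equiv.permCongr_apply]

theorem permDirectSum_sq : permDirectSum σ τ ^ 2 = permDirectSum (σ ^ 2) (τ ^ 2) := by
  ext i
  refine Fin.addCases (fun i => ?_) (fun i => ?_) i <;> simp [sq]

theorem permAvoids_p312_permDirectSum :
    PermAvoids (permDirectSum σ τ) p312 ↔ PermAvoids σ p312 ∧ PermAvoids τ p312 := by
  simp only [permAvoids_p312_iff, Fin.forall_fin_add, permDirectSum_castAdd,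
    permDirectSum_natAdd, Fin.lt_def, Fin.val_castAdd, Fin.val_natAdd]
  grind

theorem permAvoids_p321_permDirectSum :
    PermAvoids (permDirectSum σ τ) p321 ↔ PermAvoids σ p321 ∧ PermAvoids τ p321 := by
  simp only [permAvoids_p321_iff, Fin.forall_fin_add, permDirectSum_castAdd,
    permDirectSum_natAdd, Fin.lt_def, Fin.val_castAdd, Fin.val_natAdd]
  grind

theorem permDirectSum_injective :
    Function.Injective fun p : Equiv.Perm (Fin m) × Equiv.Perm (Fin l) =>
      permDirectSum p.1 p.2 := fun _ _ h =>
  Equiv.Perm.sumCongrHom_injective (finSumFinEquiv.permCongr.injective h)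

end permDirectSum

theorem exists_permDirectSum_eq {m l : ℕ} (π : Equiv.Perm (Fin (m + l)))
    (h : ∀ i : Fin m, (π (Fin.castAdd l i)).val < m) : ∃ σ τ, permDirectSum σ τ = π := by
  have key : Set.MapsTo (finSumFinEquiv.permCongr.symm π)
      (Set.range Sum.inl) (Set.range Sum.inl) := by
    rintro _ ⟨i, rfl⟩
    refine ⟨⟨_, h i⟩, ?_⟩
    rw [Equiv.permCongr_symm_apply, Equiv.eq_symm_apply]
    ext
    simp
  obtain ⟨⟨σ, τ⟩, hp⟩ := Equiv.Perm.mem_sumCongrHom_range_of_perm_mapsTo_inl key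
  exact ⟨σ, τ, (Equiv.symm_apply_eq _).1 hp.symm |>.symm⟩

/-- In a 312-avoiding permutation, the entries up to the minimum are the smallest ones. -/
theorem PermAvoids.apply_le_of_le {n : ℕ} {π : Equiv.Perm (Fin n)} (h : PermAvoids π p312)
    {k : Fin n} (hk : (π k).val = 0) {x : Fin n} (hx : x ≤ k) : π x ≤ k := by
  rw [permAvoids_p312_iff] at h
  rcases hx.eq_or_lt with rfl | hx
  · simp [Fin.le_def, hk]
  have hsub : (Finset.Ioi k).map π.toEmbedding ⊆ Finset.Ioi (π x) := by
    intro z hz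
    obtain ⟨y, hy, rfl⟩ := Finset.mem_map.1 hz
    have hy : k < y := Finset.mem_Ioi.1 hy
    have hky : π k ≠ π y := π.injective.ne hy.ne
    have hxy : π x ≠ π y := π.injective.ne (hx.trans hy).ne
    have := h x k y hx hy
    simp only [Equiv.coe_toEmbedding, Finset.mem_Ioi]
    grind
  have hcard := Finset.card_le_card hsub
  simp only [Finset.card_map, Fin.card_Ioi] at hcard
  omega

theorem card_permAvoids_of_apply_eq_zero (k l n : ℕ) (hn : k + 1 + l = n) (hk : k < n) :
    Nat.card {π : Equiv.Perm (Fin n) //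
      (PermAvoids π p312 ∧ PermAvoids (π ^ 2) p321) ∧ (π ⟨k, hk⟩).val = 0} =
    Nat.card {π : Equiv.Perm (Fin (k + 1)) //
      (PermAvoids π p312 ∧ PermAvoids (π ^ 2) p321) ∧ π (Fin.last k) = 0} *
    Nat.card {π : Equiv.Perm (Fin l) // PermAvoids π p312 ∧ PermAvoids (π ^ 2) p321} := by
  subst hn
  have hcast : (⟨k, hk⟩ : Fin (k + 1 + l)) = Fin.castAdd l (Fin.last k) := rfl
  rw [← Nat.card_prod]
  symm
  refine Nat.card_eq_of_bijective (fun p => ⟨permDirectSum p.1.1 p.2.1, ?_⟩) ⟨?_, ?_⟩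
  · obtain ⟨⟨σ, hσ, h0⟩, τ, hτ⟩ := p
    simp [permDirectSum_sq, permAvoids_p312_permDirectSum, permAvoids_p321_permDirectSum,
      hcast, hσ, hτ, h0]
  · rintro ⟨⟨σ, _⟩, τ, _⟩ ⟨⟨σ', _⟩, τ', _⟩ h
    have := @permDirectSum_injective _ _ (σ, τ) (σ', τ') (congrArg Subtype.val h)
    simp_all
  · rintro ⟨π, hπ, h0⟩
    obtain ⟨σ, τ, rfl⟩ := exists_permDirectSum_eq (m := k + 1) π fun i =>
      Nat.lt_succ_of_le (hπ.1.apply_le_of_le h0 (Nat.le_of_lt_succ i.2))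
    rw [permDirectSum_sq, permAvoids_p312_permDirectSum, permAvoids_p321_permDirectSum] at hπ
    rw [hcast, permDirectSum_castAdd, Fin.val_castAdd] at h0
    exact ⟨⟨⟨σ, ⟨hπ.1.1, hπ.2.1⟩, Fin.ext h0⟩, ⟨τ, hπ.1.2, hπ.2.2⟩⟩, rfl⟩

/-- Sorting the permutations in a class by the position of their minimum. -/
theorem card_perm_eq_sum_card_apply_eq_zero {n : ℕ} (hn : 0 < n)
    (P : Equiv.Perm (Fin n) → Prop) :
    Nat.card {π // P π} = ∑ k : Fin n, Nat.card {π // P π ∧ (π k).val = 0} := by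
  rw [← Nat.card_sigma]
  refine (Nat.card_eq_of_bijective (fun p => ⟨p.2.1, p.2.2.1⟩) ⟨?_, ?_⟩).symm
  · rintro ⟨i, π, hπ, hi⟩ ⟨j, π', hπ', hj⟩ h
    obtain rfl : π = π' := congrArg Subtype.val h
    obtain rfl : i = j := π.injective (Fin.ext (hi.trans hj.symm))
    rfl
  · rintro ⟨π, hπ⟩
    exact ⟨⟨π.symm ⟨0, hn⟩, π, hπ, by simp⟩, rfl⟩

theorem stmt12 (n : ℕ) (hn : 3 ≤ n) (c a : ℕ → ℕ)
    (hc : ∀ m : ℕ, c m = Nat.card {π : Equiv.Perm (Fin m) //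
      PermAvoids π p312 ∧ PermAvoids (π ^ 2) p321})
    (ha : ∀ m : ℕ, a (m + 1) = Nat.card {π : Equiv.Perm (Fin (m + 1)) //
      (PermAvoids π p312 ∧ PermAvoids (π ^ 2) p321) ∧ π (Fin.last m) = 0}) :
    c n = ∑ i ∈ Finset.Icc 1 n, a i * c (n - i) := by
  have hsum : ∑ i ∈ Finset.Icc 1 n, a i * c (n - i) =
      ∑ k ∈ Finset.range n, a (k + 1) * c (n - (k + 1)) := by
    rw [Finset.range_eq_Ico, Finset.sum_Ico_add' (fun i => a i * c (n - i)) 0 n 1]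
    rfl
  rw [hsum, Finset.sum_range, hc, card_perm_eq_sum_card_apply_eq_zero (by omega)]
  refine Finset.sum_congr rfl fun k _ => ?_
  rw [ha, hc]
  exact card_permAvoids_of_apply_eq_zero k (n - (k + 1)) n (by omega) k.2
end

section
/- For all integers n ≥ 5 and k ≥ 2, there is no permutation π in S_n such that π avoids both of the patterns 231 and 321 and π^k avoids the pattern 123; i.e., the number of such permutations is 0. -/
/-- A permutation avoiding 231 and 321 satisfies `i ≤ π i + 1`. -/
theorem le_apply_add_one_of_avoids {n : ℕ} {π : Equiv.Perm (Fin n)}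
    (h₁ : PermAvoids π p231) (h₂ : PermAvoids π p321) (i : Fin n) :
    (i : ℕ) ≤ (π i : ℕ) + 1 := by
  by_contra! hlt
  have hsub : Finset.Iio i ⊆ (Finset.univ.filter fun j => j < i ∧ π i < π j) ∪
      (Finset.Iio (π i)).map π.symm.toEmbedding := by
    intro j hj
    have hj' : j < i := Finset.mem_Iio.1 hj
    rcases lt_trichotomy (π j) (π i) with h | h | h
    · refine Finset.mem_union_right _ (Finset.mem_map.2 ⟨π j, Finset.mem_Iio.2 h, ?_⟩)
      simp
    · exact absurd (π.injective h) hj'.ne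
    · exact Finset.mem_union_left _ (by simp [hj', h])
  have hcard := (Finset.card_le_card hsub).trans (Finset.card_union_le _ _)
  rw [Finset.card_map, Fin.card_Iio, Fin.card_Iio] at hcard
  obtain ⟨a, ha, b, hb, hab⟩ :=
    Finset.one_lt_card.1 (by omega : 1 < (Finset.univ.filter fun j => j < i ∧ π i < π j).card)
  simp only [Finset.mem_filter, Finset.mem_univ, true_and] at ha hb
  wlog h : a < b generalizing a b
  · exact this b a hab.symm hb ha (lt_of_le_of_ne (not_lt.1 h) hab.symm)
  have hmono : StrictMono ![a, b, i] := by
    rw [Fin.strictMono_iff_lt_succ]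
    intro j
    fin_cases j
    · exact h
    · exact hb.1
  rcases lt_or_gt_of_ne (fun he => hab (π.injective he) : π a ≠ π b) with hπ | hπ
  · refine h₁ ⟨_, hmono, fun x y => ?_⟩
    have h1 := ha.2
    have h2 := hb.2
    fin_cases x <;> fin_cases y <;> simp [p231, h1, h2, hπ, h1.le, h2.le, hπ.le]
  · refine h₂ ⟨_, hmono, fun x y => ?_⟩
    have h1 := ha.2
    have h2 := hb.2
    fin_cases x <;> fin_cases y <;> simp [p321, h1, h2, hπ, h1.le, h2.le, hπ.le]

/-- The iterates of a map which rotates the interval `[s, e]` are rotations of that interval. -/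
theorem exists_iterate_eq_rotation {f : ℕ → ℕ} {s e : ℕ} (hse : s ≤ e) (hs : f s = e)
    (h : ∀ v, s ≤ v → v < e → f (v + 1) = v) (k : ℕ) :
    ∃ d, d ≤ e - s ∧ ∀ i, s ≤ i → i ≤ e →
      (f^[k] i = i + d ∧ i + d ≤ e) ∨ (i + d = f^[k] i + (e - s + 1) ∧ s ≤ f^[k] i) := by
  induction k with
  | zero => exact ⟨0, by omega, fun i _ hi => Or.inl ⟨rfl, hi⟩⟩
  | succ k ih =>
    obtain ⟨d, hd, ih⟩ := ih
    refine ⟨if d = 0 then e - s else d - 1, by split_ifs <;> omega, fun i hsi hie => ?_⟩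
    rw [Function.iterate_succ_apply']
    have hi := ih i hsi hie
    generalize f^[k] i = x at hi
    by_cases hx : x = s
    · subst hx
      rw [hs]
      split_ifs <;> omega
    · obtain ⟨v, rfl⟩ : ∃ v, x = v + 1 := ⟨x - 1, by omega⟩
      rw [h v (by omega) (by omega)]
      split_ifs <;> omega

/-- A bijection `f` of `[0, n)` with `i ≤ f i + 1` which restricts to a bijection of `[0, s)`
rotates an interval `[s, e]`. -/
theorem exists_rotation_block {n : ℕ} {f : ℕ → ℕ} (hlt : ∀ i < n, f i < n)
    (hinj : ∀ i < n, ∀ j < n, f i = f j → i = j) (hsurj : ∀ v < n, ∃ i < n, f i = v)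
    (hlow : ∀ i < n, i ≤ f i + 1) {s : ℕ} (hsn : s < n) (hs : ∀ i < s, f i < s)
    (hs' : ∀ v < s, ∃ i < s, f i = v) (k : ℕ) :
    ∃ e, s ≤ e ∧ e < n ∧ (∀ i < e + 1, f i < e + 1) ∧ (∀ v < e + 1, ∃ i < e + 1, f i = v) ∧
      ∃ d, d ≤ e - s ∧ ∀ i, s ≤ i → i ≤ e →
        (f^[k] i = i + d ∧ i + d ≤ e) ∨ (i + d = f^[k] i + (e - s + 1) ∧ s ≤ f^[k] i) := by
  have hse : s ≤ f s := by
    by_contra! h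
    obtain ⟨i, hi, hfi⟩ := hs' _ h
    have := hinj i (by omega) s hsn hfi
    omega
  have hen := hlt s hsn
  have hrot : ∀ v, s ≤ v → v < f s → f (v + 1) = v := by
    intro v
    induction v using Nat.strong_induction_on with
    | _ v ih =>
      intro hsv hve
      obtain ⟨j, hj, rfl⟩ := hsurj v (by omega)
      have h1 := hlow j hj
      have h2 : ¬ j < s := fun h => by have := hs j h; omega
      have h3 : j ≠ s := by rintro rfl; omega
      by_cases h4 : j = f j + 1
      · rw [← h4]
      · have := ih (j - 1) (by omega) (by omega) (by omega)
        rw [Nat.sub_add_cancel (by omega)] at this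
        omega
  refine ⟨f s, hse, hen, fun i hi => ?_, fun v hv => ?_,
    exists_iterate_eq_rotation hse rfl hrot k⟩
  · rcases lt_trichotomy i s with h | rfl | h
    · have := hs i h
      omega
    · omega
    · have := hrot (i - 1) (by omega) (by omega)
      rw [Nat.sub_add_cancel (by omega)] at this
      omega
  · by_cases h : v < s
    · obtain ⟨i, hi, hfi⟩ := hs' v h
      exact ⟨i, by omega, hfi⟩
    · by_cases hvs : v = f s
      · exact ⟨s, by omega, hvs.symm⟩
      · exact ⟨v + 1, by omega, hrot v (by omega) (by omega)⟩

/-- Every iterate of a bijection `f` of `[0, n)`, `n ≥ 5`, with `i ≤ f i + 1` has an increasing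
subsequence of length three. -/
theorem exists_increasing_triple_iterate {n : ℕ} {f : ℕ → ℕ} (hn : 5 ≤ n)
    (hlt : ∀ i < n, f i < n) (hinj : ∀ i < n, ∀ j < n, f i = f j → i = j)
    (hsurj : ∀ v < n, ∃ i < n, f i = v) (hlow : ∀ i < n, i ≤ f i + 1) (k : ℕ) :
    ∃ a b c, a < b ∧ b < c ∧ c < n ∧ f^[k] a < f^[k] b ∧ f^[k] b < f^[k] c := by
  obtain ⟨m, -, hmn, hm, hm', d, hd, H⟩ :=
    exists_rotation_block hlt hinj hsurj hlow (s := 0) (by omega) (by simp) (by simp) k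
  have H0 := H 0 le_rfl (by omega)
  by_cases hm4 : 4 ≤ m
  · have H1 := H 1 (by omega) (by omega)
    have H2 := H 2 (by omega) (by omega)
    have H3 := H 3 (by omega) (by omega)
    have H4 := H 4 (by omega) (by omega)
    by_cases hdm : d + 2 ≤ m
    · exact ⟨0, 1, 2, by omega⟩
    · exact ⟨2, 3, 4, by omega⟩
  obtain ⟨e, hse, hen, he, he', d', hd', G⟩ :=
    exists_rotation_block hlt hinj hsurj hlow (s := m + 1) (by omega) hm hm' k
  have G0 := G (m + 1) le_rfl hse
  by_cases hm2 : 2 ≤ m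
  · have H1 := H 1 (by omega) (by omega)
    have H2 := H 2 (by omega) (by omega)
    by_cases hdm : d + 1 ≤ m
    · exact ⟨0, 1, m + 1, by omega⟩
    · exact ⟨1, 2, m + 1, by omega⟩
  by_cases hen' : e + 1 < n
  · obtain ⟨e₂, hse₂, hen₂, -, -, d₂, hd₂, K⟩ :=
      exists_rotation_block hlt hinj hsurj hlow hen' he he' k
    have K0 := K (e + 1) le_rfl hse₂
    exact ⟨0, m + 1, e + 1, by omega⟩
  · have G1 := G (m + 2) (by omega) (by omega)
    have G2 := G (m + 3) (by omega) (by omega)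
    by_cases hdm : d' + (m + 1) + 1 ≤ e
    · exact ⟨0, m + 1, m + 2, by omega⟩
    · exact ⟨0, m + 2, m + 3, by omega⟩

theorem stmt14 (n k : ℕ) (hn : 5 ≤ n) (hk : 2 ≤ k) :
    Nat.card {π : Equiv.Perm (Fin n) //
      PermAvoids π p231 ∧ PermAvoids π p321 ∧ PermAvoids (π ^ k) p123} = 0 := by
  rw [Nat.card_eq_zero]
  left
  refine ⟨fun ⟨π, h₁, h₂, h₃⟩ => ?_⟩
  let f : ℕ → ℕ := fun i => if h : i < n then π ⟨i, h⟩ else i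
  have hf : ∀ i : Fin n, f i = π i := fun i => by simp [f]
  have hit : ∀ (k : ℕ) (i : Fin n), f^[k] i = (π ^ k) i := by
    intro k
    induction k with
    | zero => intro i; rfl
    | succ k ih =>
      intro i
      rw [Function.iterate_succ_apply', ih, hf, pow_succ', Equiv.Perm.mul_apply]
  obtain ⟨a, b, c, hab, hbc, hc, h1, h2⟩ := exists_increasing_triple_iterate (f := f) hn
    (fun i hi => by rw [hf ⟨i, hi⟩]; exact Fin.is_lt _)
    (fun i hi j hj h => by
      rw [hf ⟨i, hi⟩, hf ⟨j, hj⟩] at h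
      exact Fin.mk.inj_iff.1 (π.injective (Fin.ext h)))
    (fun v hv => ⟨π.symm ⟨v, hv⟩, Fin.is_lt _, by rw [hf]; simp⟩)
    (fun i hi => by rw [hf ⟨i, hi⟩]; exact le_apply_add_one_of_avoids h₁ h₂ ⟨i, hi⟩) k
  have hb : b < n := hbc.trans hc
  have ha : a < n := hab.trans hb
  rw [hit k ⟨a, ha⟩, hit k ⟨b, hb⟩] at h1
  rw [hit k ⟨b, hb⟩, hit k ⟨c, hc⟩] at h2
  have h1 := Fin.lt_def.2 h1
  have h2 := Fin.lt_def.2 h2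
  refine h₃ ⟨![⟨a, ha⟩, ⟨b, hb⟩, ⟨c, hc⟩], ?_, fun x y => ?_⟩
  · rw [Fin.strictMono_iff_lt_succ]
    intro j
    fin_cases j
    · exact hab
    · exact hbc
  · have h12 := h1.trans h2
    fin_cases x <;> fin_cases y <;> simp [p123, h1, h2, h12, h1.le, h2.le, h12.le]
end

section
/- Fix an integer k ≥ 2 and for n ≥ 1 let c_n^{(k)} denote the number of permutations π ∈ S_n such that π avoids both of the patterns 231 and 321 and π^k avoids the pattern 132. Then c_1^{(k)} = 1 and, for every n ≥ 2, c_n^{(k)} = 1 + Σ_{d | k, d ≤ n−1} c_{n−d}^{(k)}, where the sum is over the positive divisors d of k with n − d ≥ 1 (equivalently, c_n^{(k)} = 1 + Σ_{d | k} c_{n−d}^{(k)} with the convention that c_i^{(k)} = 0 for i ≤ 0). -/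
/-- No entry of `π` is preceded by two larger entries. -/
def AtMostOneLargerBefore {n : ℕ} (π : Equiv.Perm (Fin n)) : Prop :=
  ∀ a b c, a < b → b < c → π c < π a → π c < π b → False

/-- No entry of `π` is followed by a descending pair of larger entries. -/
def NoDescentAbove {n : ℕ} (π : Equiv.Perm (Fin n)) : Prop :=
  ∀ a b c, a < b → b < c → π a < π c → π c < π b → False

theorem permContains_three_iff {n : ℕ} (π : Equiv.Perm (Fin n)) (τ : Equiv.Perm (Fin 3)) :
    PermContains π τ ↔ ∃ a b c, a < b ∧ b < c ∧
      (∀ i j : Fin 3, τ i < τ j ↔ π (![a, b, c] i) < π (![a, b, c] j)) := by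
  constructor
  · rintro ⟨f, hf, h⟩
    refine ⟨f 0, f 1, f 2, hf (by decide), hf (by decide), ?_⟩
    have hfe : ![f 0, f 1, f 2] = f := by
      ext i
      fin_cases i <;> rfl
    rwa [hfe]
  · rintro ⟨a, b, c, hab, hbc, h⟩
    refine ⟨![a, b, c], ?_, h⟩
    rw [Fin.strictMono_iff_lt_succ]
    intro i
    fin_cases i
    · exact hab
    · exact hbc

theorem permAvoids_p132_iff {n : ℕ} (π : Equiv.Perm (Fin n)) :
    PermAvoids π p132 ↔ NoDescentAbove π := by
  unfold PermAvoids NoDescentAbove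
  rw [permContains_three_iff]
  simp only [Fin.forall_fin_succ, p132]
  simp
  grind

theorem permAvoids_p231_and_p321_iff {n : ℕ} (π : Equiv.Perm (Fin n)) :
    PermAvoids π p231 ∧ PermAvoids π p321 ↔ AtMostOneLargerBefore π := by
  unfold PermAvoids AtMostOneLargerBefore
  rw [permContains_three_iff, permContains_three_iff]
  simp only [Fin.forall_fin_succ, p231, p321]
  simp
  have hinj : ∀ a b, a < b → π a ≠ π b := fun a b h e => h.ne (π.injective e)
  grind

/-- The direct sum of two permutations. -/
def directSum {p d : ℕ} (σ : Equiv.Perm (Fin p)) (ρ : Equiv.Perm (Fin d)) :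
    Equiv.Perm (Fin (p + d)) :=
  finSumFinEquiv.permCongr (Equiv.sumCongr σ ρ)

@[simp] theorem directSum_castAdd {p d : ℕ} (σ : Equiv.Perm (Fin p)) (ρ : Equiv.Perm (Fin d))
    (i : Fin p) : directSum σ ρ (Fin.castAdd d i) = Fin.castAdd d (σ i) := by
  simp [directSum, Equiv.permCongr_apply]

@[simp] theorem directSum_natAdd {p d : ℕ} (σ : Equiv.Perm (Fin p)) (ρ : Equiv.Perm (Fin d))
    (i : Fin d) : directSum σ ρ (Fin.natAdd p i) = Fin.natAdd p (ρ i) := by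
  simp [directSum, Equiv.permCongr_apply]

theorem directSum_pow {p d : ℕ} (σ : Equiv.Perm (Fin p)) (ρ : Equiv.Perm (Fin d)) (k : ℕ) :
    directSum σ ρ ^ k = directSum (σ ^ k) (ρ ^ k) := by
  induction k with
  | zero =>
    ext i
    refine Fin.addCases (fun i => ?_) (fun i => ?_) i <;> simp
  | succ k ih =>
    ext i
    rw [pow_succ, ih, pow_succ, pow_succ]
    refine Fin.addCases (fun i => ?_) (fun i => ?_) i <;> simp

theorem atMostOneLargerBefore_directSum_iff {p d : ℕ} (σ : Equiv.Perm (Fin p))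
    (ρ : Equiv.Perm (Fin d)) : AtMostOneLargerBefore (directSum σ ρ) ↔
      AtMostOneLargerBefore σ ∧ AtMostOneLargerBefore ρ := by
  constructor
  · intro h
    constructor
    · intro a b c
      simpa only [directSum_castAdd, Fin.lt_def, Fin.val_castAdd] using
        h (Fin.castAdd d a) (Fin.castAdd d b) (Fin.castAdd d c)
    · intro a b c
      simpa using h (Fin.natAdd p a) (Fin.natAdd p b) (Fin.natAdd p c)
  · rintro ⟨h₁, h₂⟩ a b c
    refine Fin.addCases (fun a => ?_) (fun a => ?_) a <;>
    refine Fin.addCases (fun b => ?_) (fun b => ?_) b <;>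
    refine Fin.addCases (fun c => ?_) (fun c => ?_) c <;>
    simp only [directSum_castAdd, directSum_natAdd, Fin.lt_def, Fin.val_castAdd,
      Fin.val_natAdd] <;> intros
    case refine_1.refine_1.refine_1 =>
      exact h₁ a b c (by omega) (by omega) (by omega) (by omega)
    case refine_2.refine_2.refine_2 =>
      exact h₂ a b c (by omega) (by omega) (by omega) (by omega)
    all_goals omega

theorem noDescentAbove_directSum_iff {p d : ℕ} (σ : Equiv.Perm (Fin p))
    (ρ : Equiv.Perm (Fin d)) : NoDescentAbove (directSum σ ρ) ↔
      NoDescentAbove σ ∧ NoDescentAbove ρ ∧ (p = 0 ∨ ρ = 1) := by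
  constructor
  · intro h
    refine ⟨?_, ?_, ?_⟩
    · intro a b c
      simpa only [directSum_castAdd, Fin.lt_def, Fin.val_castAdd] using
        h (Fin.castAdd d a) (Fin.castAdd d b) (Fin.castAdd d c)
    · intro a b c
      simpa using h (Fin.natAdd p a) (Fin.natAdd p b) (Fin.natAdd p c)
    · refine or_iff_not_imp_left.2 fun hp => ?_
      have hmono : StrictMono ρ := by
        intro b c hbc
        by_contra hlt
        have hne : ρ b ≠ ρ c := fun e => hbc.ne (ρ.injective e)
        refine h (Fin.castAdd d ⟨0, by omega⟩) (Fin.natAdd p b) (Fin.natAdd p c) ?_ ?_ ?_ ?_ <;>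
        simp only [directSum_castAdd, directSum_natAdd, Fin.lt_def, Fin.val_castAdd,
          Fin.val_natAdd] <;> omega
      ext i
      have := Subsingleton.elim (hmono.orderIsoOfSurjective ρ ρ.surjective) (OrderIso.refl _)
      simpa using congrArg (fun e : Fin d ≃o Fin d => (e i).val) this
  · rintro ⟨h₁, h₂, h₃⟩ a b c
    refine Fin.addCases (fun a => ?_) (fun a => ?_) a <;>
    refine Fin.addCases (fun b => ?_) (fun b => ?_) b <;>
    refine Fin.addCases (fun c => ?_) (fun c => ?_) c <;>
    simp only [directSum_castAdd, directSum_natAdd, Fin.lt_def, Fin.val_castAdd,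
      Fin.val_natAdd] <;> intros
    case refine_1.refine_1.refine_1 =>
      exact h₁ a b c (by omega) (by omega) (by omega) (by omega)
    case refine_2.refine_2.refine_2 =>
      exact h₂ a b c (by omega) (by omega) (by omega) (by omega)
    case refine_1.refine_2.refine_2 =>
      rcases h₃ with rfl | rfl
      · exact a.elim0
      · simp only [Equiv.Perm.one_apply] at *
        omega
    all_goals omega

/-- The cycle with one-line notation `(m + 1) 1 2 ⋯ m`. -/
def backRotate (m : ℕ) : Equiv.Perm (Fin (m + 1)) := Equiv.addRight (-1)

theorem backRotate_pow_apply (m k : ℕ) (i : Fin (m + 1)) :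
    (backRotate m ^ k) i = i - k • (1 : Fin (m + 1)) := by
  induction k generalizing i with
  | zero => simp
  | succ k ih =>
    rw [pow_succ, Equiv.Perm.mul_apply, ih, succ_nsmul]
    simp only [backRotate, Equiv.coe_addRight]
    abel

theorem val_backRotate (m : ℕ) (i : Fin (m + 1)) :
    (backRotate m i).val = if i.val = 0 then m else i.val - 1 := by
  have h : backRotate m i = i - 1 := by simp [backRotate, sub_eq_add_neg]
  rw [h, Fin.coe_sub_one]
  simp only [Fin.ext_iff, Fin.val_zero]

theorem backRotate_pow_eq_one_iff (m k : ℕ) : backRotate m ^ k = 1 ↔ m + 1 ∣ k := by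
  have hord : addOrderOf (1 : Fin (m + 1)) = m + 1 := ZMod.addOrderOf_one (m + 1)
  have hdvd := addOrderOf_dvd_iff_nsmul_eq_zero (x := (1 : Fin (m + 1))) (n := k)
  rw [hord] at hdvd
  rw [hdvd]
  constructor
  · intro h
    have := backRotate_pow_apply m k 0
    simpa [h] using this.symm
  · intro h
    ext i
    simp [backRotate_pow_apply, h]

theorem noDescentAbove_backRotate_pow (m k : ℕ) : NoDescentAbove (backRotate m ^ k) := by
  intro a b c hab hbc h₁ h₂
  simp only [backRotate_pow_apply] at h₁ h₂
  generalize k • (1 : Fin (m + 1)) = t at h₁ h₂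
  have hsub : ∀ i : Fin (m + 1), (i - t).val = if t ≤ i then i.val - t.val
      else m + 1 + i.val - t.val := by
    intro i
    split_ifs with h
    · exact Fin.sub_val_of_le h
    · exact Fin.coe_sub_iff_lt.2 (not_le.1 h)
  simp only [Fin.lt_def, Fin.le_def, hsub] at *
  split_ifs at h₁ h₂ <;> omega

theorem atMostOneLargerBefore_backRotate (m : ℕ) : AtMostOneLargerBefore (backRotate m) := by
  intro a b c hab hbc h₁ h₂
  simp only [Fin.lt_def, val_backRotate] at *
  split_ifs at h₁ h₂ <;> omega

theorem AtMostOneLargerBefore.val_apply_of_gt {n : ℕ} {π : Equiv.Perm (Fin n)}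
    (h : AtMostOneLargerBefore π) {p i : Fin n} (hp : (π p).val + 1 = n) (hi : p < i) :
    (π i).val = i.val - 1 := by
  have hbelow : ∀ i j, p < i → j < i → j ≠ p → π j < π i := by
    intro i j hi hj hjp
    have hne : π j ≠ π i := fun e => hj.ne (π.injective e)
    have hne' : π p ≠ π i := fun e => hi.ne (π.injective e)
    have hpi : π i < π p := by omega
    by_contra hlt
    have hij : π i < π j := by omega
    rcases lt_or_gt_of_ne hjp with hl | hl
    · exact h j p i hl hi hij hpi
    · exact h p j i hl hj hpi hij
  have hset : (Finset.Iio (π i)).map π.symm.toEmbedding = (Finset.Iio i).erase p := by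
    ext j
    simp only [Finset.mem_map_equiv, Equiv.symm_symm, Finset.mem_Iio, Finset.mem_erase]
    constructor
    · intro hj
      refine ⟨by rintro rfl; omega, ?_⟩
      by_contra hji
      rcases (not_lt.1 hji).eq_or_lt with rfl | hij
      · exact lt_irrefl _ hj
      · exact lt_asymm hj (hbelow j i (hi.trans hij) hij hi.ne')
    · rintro ⟨hjp, hji⟩
      exact hbelow i j hi hji hjp
  have hcard := congrArg Finset.card hset
  rwa [Finset.card_map, Fin.card_Iio, Finset.card_erase_of_mem (by simpa using hi),
    Fin.card_Iio] at hcard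

theorem AtMostOneLargerBefore.exists_eq_directSum {p m : ℕ} {π : Equiv.Perm (Fin (p + (m + 1)))}
    (h : AtMostOneLargerBefore π) (hp : π (Fin.natAdd p 0) = Fin.last (p + m)) :
    ∃ σ : Equiv.Perm (Fin p), π = directSum σ (backRotate m) := by
  have hp' : (π (Fin.natAdd p 0)).val = p + m := by simp [hp]
  have htail : ∀ i, Fin.natAdd p 0 < i → (π i).val = i.val - 1 := fun i hi =>
    h.val_apply_of_gt (by omega) hi
  have hhead : ∀ i : Fin p, (π (Fin.castAdd (m + 1) i)).val < p := by
    intro i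
    by_contra hlt
    have hv := (π (Fin.castAdd (m + 1) i)).isLt
    by_cases hm : (π (Fin.castAdd (m + 1) i)).val = p + m
    · have := π.injective (Fin.ext (hm.trans hp'.symm))
      simp only [Fin.ext_iff, Fin.val_castAdd, Fin.val_natAdd] at this
      omega
    · let j : Fin (p + (m + 1)) := ⟨(π (Fin.castAdd (m + 1) i)).val + 1, by omega⟩
      have hj : (π j).val = (π (Fin.castAdd (m + 1) i)).val := by
        rw [htail j (by simp only [j, Fin.lt_def, Fin.val_natAdd, Fin.val_zero]; omega)]
        simp [j]
      have := π.injective (Fin.ext hj)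
      simp only [j, Fin.ext_iff, Fin.val_castAdd] at this
      omega
  have hinj : Function.Injective fun i : Fin p =>
      (⟨(π (Fin.castAdd (m + 1) i)).val, hhead i⟩ : Fin p) := by
    intro i j hij
    have hval : (π (Fin.castAdd (m + 1) i)).val = (π (Fin.castAdd (m + 1) j)).val :=
      congrArg (fun x : Fin p => x.val) hij
    exact Fin.castAdd_injective _ _ (π.injective (Fin.ext hval))
  refine ⟨Equiv.ofBijective _ (Finite.injective_iff_bijective.1 hinj), ?_⟩
  ext i
  refine Fin.addCases (fun i => ?_) (fun i => ?_) i
  · simp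
  · rw [directSum_natAdd, Fin.val_natAdd, val_backRotate]
    split_ifs with hi
    · obtain rfl : i = 0 := Fin.ext hi
      exact hp'
    · rw [htail _ (by simp only [Fin.lt_def, Fin.val_natAdd, Fin.val_zero]; omega)]
      simp only [Fin.val_natAdd]
      omega

/-- `π` avoids 231 and 321, and its `k`-th power avoids 132. -/
def PowerAvoiding (k : ℕ) {n : ℕ} (π : Equiv.Perm (Fin n)) : Prop :=
  AtMostOneLargerBefore π ∧ NoDescentAbove (π ^ k)

theorem powerAvoiding_directSum_backRotate_iff {k p m : ℕ} (σ : Equiv.Perm (Fin p)) :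
    PowerAvoiding k (directSum σ (backRotate m)) ↔
      PowerAvoiding k σ ∧ (p = 0 ∨ m + 1 ∣ k) := by
  simp only [PowerAvoiding, directSum_pow, atMostOneLargerBefore_directSum_iff,
    noDescentAbove_directSum_iff, backRotate_pow_eq_one_iff, noDescentAbove_backRotate_pow,
    atMostOneLargerBefore_backRotate]
  tauto

theorem card_powerAvoiding_fiber (k p m : ℕ) :
    Nat.card {π : Equiv.Perm (Fin (p + (m + 1))) //
      PowerAvoiding k π ∧ (π.symm (Fin.last (p + m))).val = p} =
      if p = 0 ∨ m + 1 ∣ k then Nat.card {σ : Equiv.Perm (Fin p) // PowerAvoiding k σ} else 0 := by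
  have hpos : ∀ π : Equiv.Perm (Fin (p + (m + 1))),
      (π.symm (Fin.last (p + m))).val = p ↔ π (Fin.natAdd p 0) = Fin.last (p + m) := by
    intro π
    rw [eq_comm (a := π (Fin.natAdd p 0)), ← Equiv.symm_apply_eq, Fin.ext_iff]
    simp
  split_ifs with hd
  · symm
    refine Nat.card_eq_of_bijective (fun σ => ⟨directSum σ.1 (backRotate m),
      powerAvoiding_directSum_backRotate_iff _ |>.2 ⟨σ.2, hd⟩, ?_⟩) ⟨?_, ?_⟩
    · rw [hpos, directSum_natAdd]
      ext
      simp [val_backRotate]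
    · intro σ τ hστ
      ext i
      have := DFunLike.congr_fun (congrArg Subtype.val hστ) (Fin.castAdd (m + 1) i)
      simpa [Fin.ext_iff] using this
    · rintro ⟨π, hπ, hp⟩
      obtain ⟨σ, rfl⟩ := hπ.1.exists_eq_directSum ((hpos π).1 hp)
      exact ⟨⟨σ, (powerAvoiding_directSum_backRotate_iff _ |>.1 hπ).1⟩, rfl⟩
  · have : IsEmpty {π : Equiv.Perm (Fin (p + (m + 1))) //
        PowerAvoiding k π ∧ (π.symm (Fin.last (p + m))).val = p} := by
      refine ⟨fun ⟨π, hπ, hp⟩ => hd ?_⟩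
      obtain ⟨σ, rfl⟩ := hπ.1.exists_eq_directSum ((hpos π).1 hp)
      exact (powerAvoiding_directSum_backRotate_iff _ |>.1 hπ).2
    exact Nat.card_of_isEmpty

theorem card_powerAvoiding_succ (k n : ℕ) :
    Nat.card {π : Equiv.Perm (Fin (n + 1)) // PowerAvoiding k π} =
      ∑ p ∈ Finset.range (n + 1), if p = 0 ∨ n + 1 - p ∣ k then
        Nat.card {σ : Equiv.Perm (Fin p) // PowerAvoiding k σ} else 0 := by
  classical
  have hfib : ∀ p ∈ Finset.range (n + 1),
      (if p = 0 ∨ n + 1 - p ∣ k then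
        Nat.card {σ : Equiv.Perm (Fin p) // PowerAvoiding k σ} else 0) =
      ((Finset.univ.filter fun π : Equiv.Perm (Fin (n + 1)) => PowerAvoiding k π).filter
        fun π => (π.symm (Fin.last n)).val = p).card := by
    intro p hp
    obtain ⟨m, rfl⟩ := Nat.exists_eq_add_of_le (Nat.lt_succ_iff.1 (Finset.mem_range.1 hp))
    have hm : p + m + 1 - p = m + 1 := by omega
    have h := card_powerAvoiding_fiber k p m
    rw [Nat.card_eq_fintype_card, Fintype.card_subtype] at h
    rw [Finset.filter_filter, hm]
    exact h.symm.trans (by congr! 1)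
  rw [Finset.sum_congr rfl hfib, Nat.card_eq_fintype_card, Fintype.card_subtype]
  exact Finset.card_eq_sum_card_fiberwise fun π _ => by
    simpa using (π.symm (Fin.last n)).isLt

theorem card_powerAvoiding_zero (k : ℕ) :
    Nat.card {σ : Equiv.Perm (Fin 0) // PowerAvoiding k σ} = 1 := by
  have : Inhabited {σ : Equiv.Perm (Fin 0) // PowerAvoiding k σ} :=
    ⟨1, fun a => a.elim0, fun a => a.elim0⟩
  exact Nat.card_unique

theorem stmt15 (k : ℕ) (hk : 2 ≤ k) (c : ℕ → ℕ)
    (hc : ∀ n : ℕ, 1 ≤ n → c n = Nat.card {π : Equiv.Perm (Fin n) //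
      PermAvoids π p231 ∧ PermAvoids π p321 ∧ PermAvoids (π ^ k) p132}) :
    c 1 = 1 ∧ ∀ n : ℕ, 2 ≤ n →
      c n = 1 + ∑ d ∈ (Nat.divisors k).filter (fun d => d ≤ n - 1), c (n - d) := by
  have hc' : ∀ n, 1 ≤ n → c n = Nat.card {π : Equiv.Perm (Fin n) // PowerAvoiding k π} := by
    intro n hn
    simp only [hc n hn, ← and_assoc, permAvoids_p231_and_p321_iff, permAvoids_p132_iff,
      PowerAvoiding]
  constructor
  · rw [hc' 1 le_rfl, card_powerAvoiding_succ]
    simp [card_powerAvoiding_zero]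
  · intro n hn
    obtain ⟨n, rfl⟩ : ∃ m, n = m + 1 := ⟨n - 1, by omega⟩
    rw [hc' _ (by omega), card_powerAvoiding_succ, Finset.sum_range_succ', add_comm]
    simp only [true_or, if_true, card_powerAvoiding_zero]
    congr 1
    rw [← Finset.sum_filter]
    refine Finset.sum_bij' (fun p _ => n - p) (fun d _ => n - d) ?_ ?_ ?_ ?_ ?_
    · intro p hp
      simp only [Finset.mem_filter, Finset.mem_range, Nat.mem_divisors] at hp ⊢
      have : n + 1 - (p + 1) = n - p := by omega
      rw [this] at hp
      refine ⟨⟨hp.2.resolve_left (by omega), by omega⟩, by omega⟩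
    · intro d hd
      simp only [Finset.mem_filter, Finset.mem_range, Nat.mem_divisors] at hd ⊢
      have hpos := Nat.pos_of_dvd_of_pos hd.1.1 (by omega)
      have : n + 1 - (n - d + 1) = d := by omega
      rw [this]
      exact ⟨by omega, Or.inr hd.1.1⟩
    · intro p hp
      simp only [Finset.mem_filter, Finset.mem_range] at hp
      omega
    · intro d hd
      simp only [Finset.mem_filter] at hd
      omega
    · intro p hp
      simp only [Finset.mem_filter, Finset.mem_range] at hp
      have : n + 1 - (n - p) = p + 1 := by omega
      rw [this, hc' _ (by omega)]
end

section
/- For every integer n ≥ 3, the number of permutations π in S_n such that π avoids both of the patterns 231 and 321 and π² avoids the pattern 132 equals F_{n+2} − 1, where F_j denotes the j-th Fibonacci number (F_1 = F_2 = 1, F_{j} = F_{j−1} + F_{j−2}). -/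
open Equiv

/-- A permutation of `Fin n` contains a pattern of length three iff some three increasing positions
carry values ordered as in the pattern. -/
theorem permContains_fin_three {n : ℕ} (π : Perm (Fin n)) (τ : Perm (Fin 3)) :
    PermContains π τ ↔ ∃ i j k : Fin n, i < j ∧ j < k ∧
      ∀ a b : Fin 3, τ a < τ b ↔ π (![i, j, k] a) < π (![i, j, k] b) := by
  constructor
  · rintro ⟨f, hf, h⟩
    refine ⟨f 0, f 1, f 2, hf (by decide), hf (by decide), ?_⟩
    have : ![f 0, f 1, f 2] = f := by
      ext a
      fin_cases a <;> rfl
    rwa [this]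
  · rintro ⟨i, j, k, hij, hjk, h⟩
    refine ⟨![i, j, k], ?_, h⟩
    rw [Fin.strictMono_iff_lt_succ]
    intro a
    fin_cases a
    · exact hij
    · exact hjk

theorem permContains_p231_iff {n : ℕ} (π : Perm (Fin n)) :
    PermContains π p231 ↔ ∃ i j k : Fin n, i < j ∧ j < k ∧ π k < π i ∧ π i < π j := by
  rw [permContains_fin_three]
  refine exists_congr fun i => exists_congr fun j => exists_congr fun k =>
    and_congr_right fun _ => and_congr_right fun _ => ?_
  simp [Fin.forall_fin_succ, p231]
  omega

theorem permContains_p321_iff {n : ℕ} (π : Perm (Fin n)) :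
    PermContains π p321 ↔ ∃ i j k : Fin n, i < j ∧ j < k ∧ π k < π j ∧ π j < π i := by
  rw [permContains_fin_three]
  refine exists_congr fun i => exists_congr fun j => exists_congr fun k =>
    and_congr_right fun _ => and_congr_right fun _ => ?_
  simp [Fin.forall_fin_succ, p321]
  omega

theorem permContains_p132_iff {n : ℕ} (π : Perm (Fin n)) :
    PermContains π p132 ↔ ∃ i j k : Fin n, i < j ∧ j < k ∧ π i < π k ∧ π k < π j := by
  rw [permContains_fin_three]
  refine exists_congr fun i => exists_congr fun j => exists_congr fun k =>
    and_congr_right fun _ => and_congr_right fun _ => ?_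
  simp [Fin.forall_fin_succ, p132]
  omega

/-- The permutations of `ℕ` that fix every `i ≥ n`, avoid 231 and 321, and whose square
avoids 132. -/
def avoiders (n : ℕ) : Set (Perm ℕ) :=
  {σ | (∀ i, n ≤ i → σ i = i) ∧
    (∀ i j k, i < j → j < k → σ k < σ i → σ k < σ j → False) ∧
    (∀ i j k, i < j → j < k → σ (σ i) < σ (σ k) → σ (σ k) < σ (σ j) → False)}

theorem perm_lt_of_lt {n : ℕ} {σ : Perm ℕ} (hσ : ∀ i, n ≤ i → σ i = i) {i : ℕ} (hi : i < n) :
    σ i < n := by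
  by_contra h
  have := σ.injective (hσ (σ i) (by omega))
  omega

theorem avoids_iff_mem_avoiders {n : ℕ} {π : Perm (Fin n)} {σ : Perm ℕ}
    (hσ : ∀ i, n ≤ i → σ i = i) (hπ : ∀ x : Fin n, σ x = π x) :
    PermAvoids π p231 ∧ PermAvoids π p321 ∧ PermAvoids (π ^ 2) p132 ↔ σ ∈ avoiders n := by
  have lt := @perm_lt_of_lt n σ hσ
  have hk : ∀ j k, j < k → σ k < σ j → k < n := by
    intro j k hjk h
    by_contra hk
    rw [hσ k (by omega)] at h
    by_cases hj : j < n
    · have := lt hj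
      omega
    · rw [hσ j (by omega)] at h
      omega
  have hk2 : ∀ j k, j < k → σ (σ k) < σ (σ j) → k < n := by
    intro j k hjk h
    by_contra hk
    rw [hσ k (by omega), hσ k (by omega)] at h
    by_cases hj : j < n
    · have := lt (lt hj)
      omega
    · rw [hσ j (by omega), hσ j (by omega)] at h
      omega
  simp only [PermAvoids, permContains_p231_iff, permContains_p321_iff, permContains_p132_iff,
    avoiders, Set.mem_ofPred_eq, pow_two, Perm.mul_apply, Fin.lt_def, ← hπ]
  constructor
  · rintro ⟨h1, h2, h3⟩
    refine ⟨hσ, fun i j k hij hjk hi hj => ?_, fun i j k hij hjk hi hj => ?_⟩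
    · have hkn := hk j k hjk hj
      have hne : σ i ≠ σ j := fun h => hij.ne (σ.injective h)
      rcases lt_or_gt_of_ne hne with h | h
      · exact h1 ⟨⟨i, by omega⟩, ⟨j, by omega⟩, ⟨k, hkn⟩, hij, hjk, hi, h⟩
      · exact h2 ⟨⟨i, by omega⟩, ⟨j, by omega⟩, ⟨k, hkn⟩, hij, hjk, hj, h⟩
    · have hkn := hk2 j k hjk hj
      exact h3 ⟨⟨i, by omega⟩, ⟨j, by omega⟩, ⟨k, hkn⟩, hij, hjk, hi, hj⟩
  · rintro ⟨-, h1, h2⟩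
    refine ⟨?_, ?_, ?_⟩
    · rintro ⟨i, j, k, hij, hjk, hi, hj⟩
      exact h1 i j k hij hjk hi (hi.trans hj)
    · rintro ⟨i, j, k, hij, hjk, hi, hj⟩
      exact h1 i j k hij hjk (hi.trans hj) hi
    · rintro ⟨i, j, k, hij, hjk, hi, hj⟩
      exact h2 i j k hij hjk hi hj

theorem card_avoids_eq_ncard_avoiders (n : ℕ) :
    Nat.card {π : Perm (Fin n) //
      PermAvoids π p231 ∧ PermAvoids π p321 ∧ PermAvoids (π ^ 2) p132} =
      (avoiders n).ncard := by
  let e : Perm (Fin n) ≃ {σ : Perm ℕ // ∀ i, ¬ i < n → σ i = i} :=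
    (Fin.equivSubtype.permCongr).trans (Perm.subtypeEquivSubtypePerm (· < n))
  have he : ∀ (π : Perm (Fin n)) (x : Fin n), (e π).1 x = π x := by
    intro π x
    have := Perm.ofSubtype_apply_of_mem (Fin.equivSubtype.permCongr π) (a := (x : ℕ)) x.2
    exact this
  refine Nat.card_congr ((e.subtypeEquiv (q := fun σ => σ.1 ∈ avoiders n) fun π =>
    avoids_iff_mem_avoiders (fun i hi => (e π).2 i (by omega)) (he π)).trans
      (Equiv.subtypeSubtypeEquivSubtype fun {σ} hσ i hi => hσ.1 i (by omega)))

/-- The permutation `n, 0, 1, …, n - 1` of `{0, …, n}`, fixing every larger number. -/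
def shiftCycle (n : ℕ) : Perm ℕ where
  toFun i := if i = 0 then n else if i ≤ n then i - 1 else i
  invFun i := if i = n then 0 else if i < n then i + 1 else i
  left_inv i := by dsimp only; grind
  right_inv i := by dsimp only; grind

theorem shiftCycle_apply (n i : ℕ) :
    shiftCycle n i = if i = 0 then n else if i ≤ n then i - 1 else i := rfl

theorem shiftCycle_mem_avoiders (n : ℕ) : shiftCycle n ∈ avoiders (n + 1) := by
  refine ⟨?_, ?_, ?_⟩
  · intro i hi
    rw [shiftCycle_apply]
    grind
  · intro i j k hij hjk
    simp only [shiftCycle_apply]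
    grind
  · intro i j k hij hjk
    simp only [shiftCycle_apply]
    grind

theorem avoiders_mono_succ (n : ℕ) : avoiders n ⊆ avoiders (n + 1) :=
  fun _ hσ => ⟨fun i hi => hσ.1 i (by omega), hσ.2⟩

theorem mul_swap_mem_avoiders_iff {n : ℕ} {τ : Perm ℕ} (hτ : ∀ i, n ≤ i → τ i = i) :
    τ * swap n (n + 1) ∈ avoiders (n + 2) ↔ τ ∈ avoiders n := by
  have lt := @perm_lt_of_lt n τ hτ
  have happ : ∀ i, (τ * swap n (n + 1)) i =
      if i = n then n + 1 else if i = n + 1 then n else τ i := by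
    intro i
    rw [Perm.mul_apply, swap_apply_def]
    have h1 := hτ n (by omega)
    have h2 := hτ (n + 1) (by omega)
    split_ifs <;> first | assumption | rfl
  have hsq : ∀ i, (τ * swap n (n + 1)) ((τ * swap n (n + 1)) i) = τ (τ i) := by
    intro i
    have h1 := hτ n (by omega)
    have h2 := hτ (n + 1) (by omega)
    rw [happ i]
    split_ifs with h h'
    · subst h; rw [happ]; simp [h1]
    · subst h'; rw [happ]; simp [h2]
    · rw [happ, if_neg (fun h3 => h (τ.injective (h3.trans h1.symm))),
        if_neg (fun h3 => h' (τ.injective (h3.trans h2.symm)))]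
  simp only [avoiders, Set.mem_ofPred_eq, hsq]
  constructor
  · rintro ⟨-, h1, h2⟩
    refine ⟨hτ, fun i j k hij hjk hi hj => ?_, h2⟩
    have hk : k < n := by
      by_contra hk
      rw [hτ k (by omega)] at hj
      by_cases hjn : j < n
      · have := lt hjn
        omega
      · rw [hτ j (by omega)] at hj
        omega
    apply h1 i j k hij hjk <;> simp only [happ] <;> grind
  · rintro ⟨-, h1, h2⟩
    refine ⟨fun i hi => ?_, fun i j k hij hjk hi hj => ?_, h2⟩
    · rw [happ, hτ i (by omega)]
      grind
    · have hi' := @lt i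
      have hj' := @lt j
      have hi2 := hτ i
      have hj2 := hτ j
      have hk2 := hτ k
      have h1' := h1 i j k hij hjk
      simp only [happ] at hi hj
      grind

/-- An element of `avoiders (n + 1)` that moves `n` sends some `p < n` to `n` and shifts everything
in `(p, n]` down by one. -/
theorem exists_last_block {n : ℕ} {σ : Perm ℕ} (hσ : σ ∈ avoiders (n + 1)) (hn : σ n ≠ n) :
    ∃ p < n, σ p = n ∧ ∀ i, p < i → i ≤ n → σ i = i - 1 := by
  obtain ⟨hfix, hav, -⟩ := hσ
  obtain ⟨p, hp⟩ := σ.surjective n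
  have hpn : p < n := by
    by_contra h
    rcases (not_lt.mp h).eq_or_lt with h | h
    · exact hn (h ▸ hp)
    · have := hfix p (by omega)
      omega
  refine ⟨p, hpn, hp, fun i hpi hin => ?_⟩
  induction hd : n - i using Nat.strong_induction_on generalizing i with
  | _ d ih =>
    have later : ∀ j, i < j → j ≤ n → σ j = j - 1 :=
      fun j hij hj => ih (n - j) (by omega) j (by omega) hj rfl
    have hne : ∀ j, j ≠ i → σ j ≠ σ i := fun j hj h => hj (σ.injective h)
    have hlt : σ i < n + 1 := perm_lt_of_lt hfix (by omega)
    have hle : σ i ≤ i - 1 := by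
      by_contra h
      by_cases hv : σ i = n
      · exact hne p (by omega) (hp.trans hv.symm)
      · exact hne (σ i + 1) (by omega) (later _ (by omega) (by omega))
    by_contra hi
    obtain ⟨q, hq⟩ := σ.surjective (i - 1)
    have hqi : q < i := by
      by_contra h
      have h1 : q ≠ i := by
        rintro rfl
        omega
      by_cases hqn : q ≤ n
      · have := later q (by omega) hqn
        omega
      · have := hfix q (by omega)
        omega
    have hqp : q ≠ p := by
      rintro rfl
      omega
    rcases lt_or_gt_of_ne hqp with h | h
    · exact hav q p i h hpi (by omega) (by omega)
    · exact hav p q i h hqi (by omega) (by omega)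

theorem avoiders_add_three (m : ℕ) :
    avoiders (m + 3) =
      insert (shiftCycle (m + 2))
        (avoiders (m + 2) ∪ (· * swap (m + 1) (m + 2)) '' avoiders (m + 1)) := by
  ext σ
  simp only [Set.mem_insert_iff, Set.mem_union, Set.mem_image]
  constructor
  · intro hσ
    by_cases hn : σ (m + 2) = m + 2
    · refine Or.inr (Or.inl ⟨fun i hi => ?_, hσ.2⟩)
      rcases hi.eq_or_lt with h | h
      · rw [← h, hn]
      · exact hσ.1 i h
    obtain ⟨p, hpn, hp, hshift⟩ := exists_last_block hσ hn
    have hfix := hσ.1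
    rcases Nat.eq_zero_or_pos p with rfl | hp0
    · left
      ext i
      rw [shiftCycle_apply]
      split_ifs with h h'
      · rw [h, hp]
      · exact hshift i (by omega) h'
      · exact hfix i (by omega)
    by_cases hpm : p = m + 1
    · subst hpm
      right; right
      have hlast := hshift (m + 2) (by omega) le_rfl
      have hτ : ∀ i, m + 1 ≤ i → (σ * swap (m + 1) (m + 2)) i = i := by
        intro i hi
        rw [Perm.mul_apply, swap_apply_def]
        split_ifs with h h'
        · rw [hlast, h]
          rfl
        · rw [hp, h']
        · exact hfix i (by omega)
      have hmul : σ * swap (m + 1) (m + 2) * swap (m + 1) (m + 2) = σ := by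
        rw [mul_assoc, swap_mul_self, mul_one]
      refine ⟨σ * swap (m + 1) (m + 2), (mul_swap_mem_avoiders_iff hτ).1 ?_, hmul⟩
      rwa [hmul]
    · exfalso
      have small : ∀ i, i < p → σ i < p := by
        intro i hi
        by_contra h
        have hlt : σ i < m + 3 := perm_lt_of_lt hfix (by omega)
        have hne : ∀ j, j ≠ i → σ j ≠ σ i := fun j hj h => hj (σ.injective h)
        by_cases hv : σ i = m + 2
        · exact hne p (by omega) (hp.trans hv.symm)
        · exact hne (σ i + 1) (by omega) (hshift _ (by omega) (by omega))
      have h0 := small _ (small 0 hp0)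
      have h2 : σ (σ (p + 2)) = p := by
        rw [hshift (p + 2) (by omega) (by omega)]
        exact hshift (p + 1) (by omega) (by omega)
      have h1 : σ (σ p) = m + 1 := by
        rw [hp]
        exact hshift (m + 2) (by omega) le_rfl
      exact hσ.2.2 0 p (p + 2) hp0 (by omega) (by omega) (by omega)
  · rintro (rfl | h | ⟨τ, hτ, rfl⟩)
    · exact shiftCycle_mem_avoiders (m + 2)
    · exact avoiders_mono_succ _ h
    · exact (mul_swap_mem_avoiders_iff hτ.1).2 hτ

theorem avoiders_one : avoiders 1 = {1} := by
  ext σ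
  constructor
  · intro hσ
    ext i
    rcases Nat.eq_zero_or_pos i with rfl | h
    · have := perm_lt_of_lt hσ.1 one_pos
      simpa using this
    · exact hσ.1 i h
  · rintro rfl
    refine ⟨fun _ _ => rfl, ?_, ?_⟩ <;> intro i j k <;> simp only [Perm.one_apply] <;> omega

theorem avoiders_two : avoiders 2 = insert (shiftCycle 1) (avoiders 1) := by
  ext σ
  rw [Set.mem_insert_iff]
  constructor
  · intro hσ
    by_cases hn : σ 1 = 1
    · refine Or.inr ⟨fun i hi => ?_, hσ.2⟩
      rcases hi.eq_or_lt with h | h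
      · rw [← h, hn]
      · exact hσ.1 i h
    · obtain ⟨p, hpn, hp, hshift⟩ := exists_last_block hσ hn
      obtain rfl : p = 0 := by omega
      left
      ext i
      rw [shiftCycle_apply]
      split_ifs with h h'
      · rw [h, hp]
      · exact hshift i (by omega) h'
      · exact hσ.1 i (by omega)
  · rintro (rfl | h)
    · exact shiftCycle_mem_avoiders 1
    · exact avoiders_mono_succ _ h

theorem shiftCycle_notMem_avoiders {n : ℕ} (hn : 1 ≤ n) : shiftCycle n ∉ avoiders n := by
  intro h
  have := h.1 n le_rfl
  rw [shiftCycle_apply] at this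
  grind

theorem avoiders_finite_and_ncard (m : ℕ) :
    (avoiders (m + 1)).Finite ∧ (avoiders (m + 1)).ncard + 1 = Nat.fib (m + 3) := by
  induction m using Nat.twoStepInduction with
  | zero =>
    rw [avoiders_one]
    exact ⟨Set.finite_singleton 1, by rw [Set.ncard_singleton]; rfl⟩
  | one =>
    have hfin : (avoiders 1).Finite := avoiders_one ▸ Set.finite_singleton 1
    rw [avoiders_two]
    refine ⟨hfin.insert _, ?_⟩
    rw [Set.ncard_insert_of_notMem (shiftCycle_notMem_avoiders le_rfl) hfin, avoiders_one,
      Set.ncard_singleton]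
    rfl
  | more m ih1 ih2 =>
    obtain ⟨fin1, card1⟩ := ih1
    obtain ⟨fin2, card2⟩ := ih2
    have himage := fin1.image (· * swap (m + 1) (m + 2))
    have hdisj : Disjoint (avoiders (m + 2))
        ((· * swap (m + 1) (m + 2)) '' avoiders (m + 1)) := by
      rw [Set.disjoint_right]
      rintro _ ⟨τ, hτ, rfl⟩ h
      have h1 := h.1 (m + 2) le_rfl
      have h2 := hτ.1 (m + 1) le_rfl
      simp only [Perm.mul_apply, swap_apply_right] at h1
      omega
    have hnew : shiftCycle (m + 2) ∉
        avoiders (m + 2) ∪ (· * swap (m + 1) (m + 2)) '' avoiders (m + 1) := by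
      rintro (h | ⟨τ, hτ, h⟩)
      · exact shiftCycle_notMem_avoiders (by omega) h
      · have h1 := DFunLike.congr_fun h (m + 1)
        have h2 := hτ.1 (m + 2) (by omega)
        simp only [Perm.mul_apply, swap_apply_left, shiftCycle_apply] at h1
        grind
    rw [show m + 2 + 1 = m + 3 from rfl, avoiders_add_three]
    refine ⟨(fin2.union himage).insert _, ?_⟩
    rw [Set.ncard_insert_of_notMem hnew (fin2.union himage),
      Set.ncard_union_eq hdisj fin2 himage,
      Set.ncard_image_of_injective _ (mul_left_injective _),
      show m + 2 + 3 = m + 3 + 2 from rfl, Nat.fib_add_two, ← card1,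
      show m + 3 + 1 = m + 1 + 3 from rfl, ← card2]
    ring

theorem stmt16 (n : ℕ) (hn : 3 ≤ n) :
    Nat.card {π : Equiv.Perm (Fin n) //
      PermAvoids π p231 ∧ PermAvoids π p321 ∧ PermAvoids (π ^ 2) p132} =
      Nat.fib (n + 2) - 1 := by
  obtain ⟨m, rfl⟩ : ∃ m, n = m + 1 := ⟨n - 1, by omega⟩
  rw [card_avoids_eq_ncard_avoiders, ← (avoiders_finite_and_ncard m).2, Nat.add_sub_cancel]
end
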